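/- arXiv:1702.05356 — 4 statements merged into one kernel-verified Lean document; each statement's English description precedes it below -/
import Mathlib

section
/- Let Γ={g₁,…,g_k} be a finite admissible set of orientation-preserving circle homeomorphisms. Then the action of Γ is either equicontinuous or contractive: either the family {g_w : w a finite word} is equicontinuous, or for every x∈S¹ there exist an open arc I containing x and a sequence of finite words w_m such that the Haar measure of g_{w_m}(I) tends to 0 as m→∞. -/
open MeasureTheory Filter Topology

noncomputable section

/-- The circle `ℝ/ℤ` with normalized arc length (Haar probability measure as `volume`). -/
abbrev S1 : Type := UnitAddCircle

/-- `h` is an orientation-preserving circle homeomorphism: it admits a strictly increasing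
continuous lift `G : ℝ → ℝ` with `G (t+1) = G t + 1`. -/
def IsOPH (h : S1 ≃ₜ S1) : Prop :=
  ∃ G : ℝ → ℝ, StrictMono G ∧ Continuous G ∧ (∀ t, G (t + 1) = G t + 1) ∧
    ∀ t : ℝ, h ((t : ℝ) : S1) = ((G t : ℝ) : S1)

/-- For a word `w = [i₁, …, i_n]`, `applyWord g w = g_{i_n} ∘ ⋯ ∘ g_{i_1}`. -/
def applyWord {k : ℕ} (g : Fin k → S1 ≃ₜ S1) (w : List (Fin k)) (x : S1) : S1 :=
  w.foldl (fun y i => g i y) x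

/-- `Γ` is admissible: some generator has a dense forward orbit `{gᵢⁿ x : n ≥ 1}`. -/
def Admissible {k : ℕ} (g : Fin k → S1 ≃ₜ S1) : Prop :=
  ∃ i : Fin k, ∃ x : S1, Dense (Set.range fun n : ℕ => (⇑(g i))^[n + 1] x)

/-- The action of `Γ` is contractive: every `x` has an open arc neighbourhood whose image
under suitable words has Haar measure tending to `0`. -/
def Contractive {k : ℕ} (g : Fin k → S1 ≃ₜ S1) : Prop :=
  ∀ x : S1, ∃ a b : ℝ, a < b ∧ b - a < 1 ∧
    x ∈ (fun t : ℝ => (t : S1)) '' Set.Ioo a b ∧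
    ∃ w : ℕ → List (Fin k),
      Tendsto (fun m => volume (applyWord g (w m) '' ((fun t : ℝ => (t : S1)) '' Set.Ioo a b)))
        atTop (𝓝 0)

/-- The Markov operator `P μ = ∑ᵢ pᵢ • (gᵢ)_* μ` of the IFS `(Γ, p)`. -/
def markovP {k : ℕ} (p : Fin k → ℝ) (g : Fin k → S1 ≃ₜ S1) (μ : Measure S1) : Measure S1 :=
  ∑ i : Fin k, ENNReal.ofReal (p i) • Measure.map (g i) μ

/-- The dual operator `P* f x = ∑ᵢ pᵢ f (gᵢ x)`. -/
def dualP {k : ℕ} (p : Fin k → ℝ) (g : Fin k → S1 ≃ₜ S1) (f : S1 → ℝ) (x : S1) : ℝ :=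
  ∑ i : Fin k, p i * f (g i x)

/-- Asymptotic stability of the IFS `(Γ, p)`: there is a unique invariant Borel probability
measure `μ*`, and `Pⁿ μ → μ*` weakly for every Borel probability measure `μ`. -/
def AsympStable {k : ℕ} (p : Fin k → ℝ) (g : Fin k → S1 ≃ₜ S1) : Prop :=
  ∃ μs : Measure S1, IsProbabilityMeasure μs ∧ markovP p g μs = μs ∧
    (∀ ν : Measure S1, IsProbabilityMeasure ν → markovP p g ν = ν → ν = μs) ∧
    ∀ μ : Measure S1, IsProbabilityMeasure μ → ∀ f : C(S1, ℝ),
      Tendsto (fun n => ∫ x, f x ∂((markovP p g)^[n] μ)) atTop (𝓝 (∫ x, f x ∂μs))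

/-- `F` is a strictly increasing continuous degree one lift of `f`. -/
structure IsLift (F : ℝ → ℝ) (f : S1 → S1) : Prop where
  strictMono : StrictMono F
  continuous : Continuous F
  map_add_one : ∀ t, F (t + 1) = F t + 1
  map_coe : ∀ t : ℝ, f (t : S1) = (F t : S1)

namespace IsLift

variable {F H : ℝ → ℝ} {f h : S1 → S1}

theorem refl : IsLift id id :=
  ⟨strictMono_id, continuous_id, fun _ => rfl, fun _ => rfl⟩

theorem comp (hH : IsLift H h) (hF : IsLift F f) : IsLift (H ∘ F) (h ∘ f) where
  strictMono := hH.strictMono.comp hF.strictMono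
  continuous := hH.continuous.comp hF.continuous
  map_add_one t := by simp [hF.map_add_one, hH.map_add_one]
  map_coe t := by simp [hF.map_coe, hH.map_coe]

theorem iterate (hF : IsLift F f) : ∀ n : ℕ, IsLift F^[n] f^[n]
  | 0 => refl
  | n + 1 => by
    rw [Function.iterate_succ, Function.iterate_succ]
    exact (iterate hF n).comp hF

theorem map_add_int (hF : IsLift F f) (t : ℝ) (m : ℤ) : F (t + m) = F t + m := by
  induction m using Int.induction_on with
  | zero => simp
  | succ i ih =>
    have := hF.map_add_one (t + (i : ℤ))
    push_cast at *
    rw [← add_assoc, this, ih, add_assoc]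
  | pred i ih =>
    have := hF.map_add_one (t + ((-(i : ℤ) - 1 : ℤ) : ℝ))
    have e : t + ((-(i : ℤ) - 1 : ℤ) : ℝ) + 1 = t + ((-(i : ℤ) : ℤ) : ℝ) := by push_cast; ring
    rw [e, ih] at this
    push_cast at *
    linarith

theorem add_int (hF : IsLift F f) (m : ℤ) : IsLift (fun t => F t + m) f where
  strictMono := hF.strictMono.add_const _
  continuous := hF.continuous.add continuous_const
  map_add_one t := by simp only [hF.map_add_one]; ring
  map_coe t := by
    rw [hF.map_coe, AddCircle.coe_add]
    have : ((m : ℝ) : S1) = 0 := by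
      rw [AddCircle.coe_eq_zero_iff]; exact ⟨m, by simp⟩
    rw [this, add_zero]

theorem surjective (hF : IsLift F f) : Function.Surjective F := by
  intro y
  have h0 := hF.map_add_int 0 ⌊y - F 0⌋
  have h1 := hF.map_add_int 0 (⌊y - F 0⌋ + 1)
  have l := Int.floor_le (y - F 0)
  have u := Int.lt_floor_add_one (y - F 0)
  push_cast at h1
  exact mem_range_of_exists_le_of_exists_ge hF.continuous
    ⟨0 + ⌊y - F 0⌋, by rw [h0]; linarith⟩ ⟨0 + (⌊y - F 0⌋ + 1), by rw [h1]; linarith⟩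

theorem map_surjective (hF : IsLift F f) : Function.Surjective f := by
  intro y
  obtain ⟨t, rfl⟩ := QuotientAddGroup.mk_surjective y
  obtain ⟨s, rfl⟩ := hF.surjective t
  exact ⟨(s : S1), hF.map_coe s⟩

end IsLift

theorem coe_eq_coe_iff_add_int {s t : ℝ} : (s : S1) = (t : S1) ↔ ∃ m : ℤ, s + m = t := by
  rw [eq_comm, ← sub_eq_zero, ← AddCircle.coe_sub, AddCircle.coe_eq_zero_iff]
  refine exists_congr fun m => ?_
  rw [zsmul_eq_mul, mul_one]
  constructor <;> intro h <;> linarith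

instance : Nontrivial S1 := by
  refine ⟨((0 : ℝ) : S1), ((1 / 2 : ℝ) : S1), fun h => ?_⟩
  obtain ⟨m, hm⟩ := coe_eq_coe_iff_add_int.1 h
  have h2 : ((2 * m : ℤ) : ℝ) = (1 : ℤ) := by push_cast; linarith
  have := Int.cast_injective h2
  omega

theorem norm_coe_le_abs (t : ℝ) : ‖(t : S1)‖ ≤ |t| :=
  QuotientAddGroup.norm_mk_le_norm

theorem isOpen_coe_image {U : Set ℝ} (hU : IsOpen U) :
    IsOpen ((fun t : ℝ => (t : S1)) '' U) :=
  QuotientAddGroup.isOpenMap_coe U hU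

theorem volume_coe_image_Ioo_le (c d : ℝ) :
    volume ((fun t : ℝ => (t : S1)) '' Set.Ioo c d) ≤ ENNReal.ofReal (d - c) := by
  calc volume ((fun t : ℝ => (t : S1)) '' Set.Ioo c d)
      ≤ volume (Metric.closedBall (((c + d) / 2 : ℝ) : S1) ((d - c) / 2)) := by
        refine measure_mono ?_
        rintro _ ⟨t, ⟨h1, h2⟩, rfl⟩
        rw [Metric.mem_closedBall, dist_eq_norm, ← AddCircle.coe_sub]
        refine (norm_coe_le_abs _ ).trans (abs_le.2 ⟨by linarith, by linarith⟩)
    _ ≤ ENNReal.ofReal (d - c) := by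
        rw [AddCircle.volume_closedBall]
        exact ENNReal.ofReal_le_ofReal ((min_le_right _ _).trans (by linarith))

section DenseOrbit

variable {F : ℝ → ℝ} {f : S1 → S1}

/-- Two points of a lifted orbit of a circle map whose lift `H` moves `t` but has a fixed point
cannot both lie in the fundamental domain between `t` and `H t`. -/
theorem IsLift.notMem_wandering_of_lt {H : ℝ → ℝ} (hH : IsLift H f) {p t : ℝ}
    (hp : H p = p) (ht : t < H t) {z : ℝ} (hz : z ∈ Set.Ioo t (H t)) {j : ℕ} (hj : j ≠ 0)
    (m : ℤ) : H^[j] z + m ∉ Set.Ioo t (H t) := by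
  rintro ⟨h1, h2⟩
  obtain ⟨j, rfl⟩ := Nat.exists_eq_succ_of_ne_zero hj
  set q : ℝ := p + ⌊t - p⌋ with hq
  have hHq : H q = q := by rw [hq, hH.map_add_int, hp]
  have hHq' : H (q + 1) = q + 1 := by rw [hH.map_add_one, hHq]
  have l := Int.floor_le (t - p)
  have u := Int.lt_floor_add_one (t - p)
  have hHt : H t < q + 1 := by rw [← hHq']; exact hH.strictMono (by linarith)
  have hup : H^[j + 1] z < q + 1 := by
    have := (hH.iterate (j + 1)).strictMono (show z < q + 1 by linarith [hz.2])
    rwa [Function.iterate_fixed hHq'] at this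
  have hmono : Monotone fun n => H^[n] t := hH.strictMono.monotone.monotone_iterate_of_le_map ht.le
  have hlow : H t < H^[j + 1] z :=
    (hmono (show 1 ≤ j + 1 by omega)).trans_lt ((hH.iterate (j + 1)).strictMono hz.1)
  have hm : (m : ℝ) < 0 := by linarith
  have hm' : (m : ℝ) ≤ -1 := by
    have : m < 0 := by exact_mod_cast hm
    exact_mod_cast (show m ≤ -1 by omega)
  linarith

theorem IsLift.notMem_wandering_of_gt {H : ℝ → ℝ} (hH : IsLift H f) {p t : ℝ}
    (hp : H p = p) (ht : H t < t) {z : ℝ} (hz : z ∈ Set.Ioo (H t) t) {j : ℕ} (hj : j ≠ 0)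
    (m : ℤ) : H^[j] z + m ∉ Set.Ioo (H t) t := by
  rintro ⟨h1, h2⟩
  obtain ⟨j, rfl⟩ := Nat.exists_eq_succ_of_ne_zero hj
  set q : ℝ := p + ⌈t - p⌉ with hq
  have hHq : H q = q := by rw [hq, hH.map_add_int, hp]
  have hHq' : H (q - 1) = q - 1 := by
    have := hH.map_add_one (q - 1)
    rw [sub_add_cancel, hHq] at this
    linarith
  have l := Int.le_ceil (t - p)
  have u := Int.ceil_lt_add_one (t - p)
  have hHt : q - 1 < H t := by rw [← hHq']; exact hH.strictMono (by linarith)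
  have hup : q - 1 < H^[j + 1] z := by
    have := (hH.iterate (j + 1)).strictMono (show q - 1 < z by linarith [hz.1])
    rwa [Function.iterate_fixed hHq'] at this
  have hanti : Antitone fun n => H^[n] t := hH.strictMono.monotone.antitone_iterate_of_map_le ht.le
  have hlow : H^[j + 1] z < H t :=
    ((hH.iterate (j + 1)).strictMono hz.2).trans_le (hanti (show 1 ≤ j + 1 by omega))
  have hm : (0 : ℝ) < m := by linarith
  have hm' : (1 : ℝ) ≤ m := by
    have : 0 < m := by exact_mod_cast hm
    exact_mod_cast (show 1 ≤ m by omega)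
  linarith

/-- A dense forward orbit meets every nonempty open set infinitely often. -/
theorem infinite_setOf_iterate_mem {x : S1} (hx : Dense (Set.range fun n : ℕ => f^[n + 1] x))
    {U : Set S1} (hU : IsOpen U) (hne : U.Nonempty) :
    {r : ℕ | f^[r + 1] x ∈ U}.Infinite := by
  intro hfin
  have hd := hx.sdiff_finite (hfin.image fun r => f^[r + 1] x)
  obtain ⟨_, hyU, ⟨r, rfl⟩, hr⟩ := hd.inter_open_nonempty U hU hne
  exact hr ⟨r, hyU, rfl⟩

/-- If a map has a dense forward orbit, no lift of an iterate of it has a fixed point. -/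
theorem IsLift.iterate_add_int_ne (hF : IsLift F f) {x : S1}
    (hx : Dense (Set.range fun n : ℕ => f^[n + 1] x)) {n : ℕ} (hn : n ≠ 0) (m : ℤ) (p : ℝ) :
    F^[n] p + m ≠ p := by
  intro hp
  obtain ⟨t, rfl⟩ := QuotientAddGroup.mk_surjective x
  set H : ℝ → ℝ := fun s => F^[n] s + m
  have hH : IsLift H f^[n] := (hF.iterate n).add_int m
  have key : ∀ U : Set ℝ, IsOpen U → U.Nonempty →
      (∀ z ∈ U, ∀ j : ℕ, j ≠ 0 → ∀ l : ℤ, H^[j] z + l ∉ U) → False := by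
    intro U hU hne hw
    refine infinite_setOf_iterate_mem hx (isOpen_coe_image hU) (hne.image _) ?_
    refine Set.Finite.of_finite_image (f := fun r => r % n)
      ((Set.finite_lt_nat n).subset ?_) ?_
    · rintro _ ⟨r, -, rfl⟩
      exact Nat.mod_lt _ (Nat.pos_of_ne_zero hn)
    · have main : ∀ r j : ℕ, j ≠ 0 → f^[r + 1] (t : S1) ∈ (fun t : ℝ => (t : S1)) '' U →
          f^[r + n * j + 1] (t : S1) ∉ (fun t : ℝ => (t : S1)) '' U := by
        rintro r j hj ⟨z, hz, hzr⟩ ⟨y, hy, hyr⟩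
        have e : f^[r + n * j + 1] (t : S1) = (f^[n])^[j] (f^[r + 1] (t : S1)) := by
          rw [← Function.iterate_mul, ← Function.iterate_add_apply]
          rw [show n * j + (r + 1) = r + n * j + 1 by ring]
        rw [e, ← hzr] at hyr
        simp only [(hH.iterate j).map_coe] at hyr
        obtain ⟨l, hl⟩ := coe_eq_coe_iff_add_int.1 hyr.symm
        exact hw z hz j hj l (hl ▸ hy)
      have aux : ∀ r s : ℕ, r < s → r % n = s % n →
          f^[r + 1] (t : S1) ∈ (fun t : ℝ => (t : S1)) '' U →
          f^[s + 1] (t : S1) ∉ (fun t : ℝ => (t : S1)) '' U := by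
        intro r s hlt hmod hr
        obtain ⟨j, hj⟩ := (Nat.modEq_iff_dvd' hlt.le).1 hmod
        have hs : s = r + n * j := by omega
        have hj0 : j ≠ 0 := by rintro rfl; simp at hs; omega
        rw [hs]
        exact main r j hj0 hr
      intro r hr s hs hmod
      rcases lt_trichotomy r s with h | h | h
      · exact absurd hs (aux r s h hmod hr)
      · exact h
      · exact absurd hr (aux s r h hmod.symm hs)
  rcases lt_trichotomy t (H t) with h | h | h
  · exact key (Set.Ioo t (H t)) isOpen_Ioo (Set.nonempty_Ioo.2 h) fun z hz j hj l =>
      hH.notMem_wandering_of_lt hp h hz hj l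
  · have hper : f^[n] (t : S1) = t := by rw [hH.map_coe, ← h]
    have hfin : (Set.range fun r : ℕ => f^[r + 1] (t : S1)).Finite := by
      refine ((Set.finite_lt_nat n).image fun r => f^[r] (t : S1)).subset ?_
      rintro _ ⟨r, rfl⟩
      exact ⟨(r + 1) % n, Nat.mod_lt _ (Nat.pos_of_ne_zero hn),
        Function.IsPeriodicPt.iterate_mod_apply hper _⟩
    have hx' := hx.sdiff_finite hfin
    rw [Set.sdiff_self] at hx'
    exact (hx'.nonempty).ne_empty rfl
  · exact key (Set.Ioo (H t) t) isOpen_Ioo (Set.nonempty_Ioo.2 h) fun z hz j hj l =>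
      hH.notMem_wandering_of_gt hp h hz hj l

theorem exists_iterate_mem_Ioc_of_lt {H : ℝ → ℝ} (hmono : StrictMono H) (hc : Continuous H)
    (hfix : ∀ s, H s ≠ s) {y x : ℝ} (hy : y < H y) (hxy : x ≤ y) :
    ∃ j : ℕ, H^[j] x ∈ Set.Ioc y (H y) := by
  have hlt : ∀ s, s < H s := by
    intro s
    by_contra hs
    have := mem_range_of_exists_le_of_exists_ge (c := (0 : ℝ)) (hc.sub continuous_id)
      ⟨s, by simpa using not_lt.1 hs⟩ ⟨y, by simpa using hy.le⟩
    obtain ⟨z, hz⟩ := this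
    exact hfix z (sub_eq_zero.1 hz)
  have hm : Monotone fun n => H^[n] x := hmono.monotone.monotone_iterate_of_le_map (hlt x).le
  have hex : ∃ j, y < H^[j] x := by
    rcases tendsto_atTop_of_monotone hm with h | ⟨l, hl⟩
    · exact (h.eventually_gt_atTop y).exists
    · exact absurd (isFixedPt_of_tendsto_iterate hl hc.continuousAt) (hfix l)
  classical
  refine ⟨Nat.find hex, Nat.find_spec hex, ?_⟩
  have h0 : Nat.find hex ≠ 0 := by
    intro h0
    have := Nat.find_spec hex
    rw [h0] at this
    exact absurd hxy (not_le.2 this)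
  obtain ⟨i, hi⟩ := Nat.exists_eq_succ_of_ne_zero h0
  have := Nat.find_min hex (show i < Nat.find hex by omega)
  rw [hi, Function.iterate_succ_apply']
  exact hmono.monotone (not_lt.1 this)

theorem exists_iterate_mem_Ico_of_gt {H : ℝ → ℝ} (hmono : StrictMono H) (hc : Continuous H)
    (hfix : ∀ s, H s ≠ s) {y x : ℝ} (hy : H y < y) (hxy : y ≤ x) :
    ∃ j : ℕ, H^[j] x ∈ Set.Ico (H y) y := by
  have hconj : Function.Semiconj (fun t : ℝ => -t) H fun s => -H (-s) := fun s => by simp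
  obtain ⟨j, hj⟩ := exists_iterate_mem_Ioc_of_lt (H := fun s => -H (-s)) (y := -y) (x := -x)
    (fun a b hab => neg_lt_neg (hmono (neg_lt_neg hab))) (by fun_prop)
    (fun s hs => hfix (-s) (by linarith)) (by simpa using hy) (by linarith)
  rw [← hconj.iterate_right j x] at hj
  simp only [neg_neg, Set.mem_Ioc] at hj
  exact ⟨j, by linarith [hj.2], by linarith [hj.1]⟩

/-- If some forward orbit is dense, then every forward orbit meets every arc. -/
theorem IsLift.exists_iterate_mem (hF : IsLift F f) {x : S1}
    (hx : Dense (Set.range fun n : ℕ => f^[n + 1] x)) {a b : ℝ} (hab : a < b) (s : ℝ) :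
    ∃ (n : ℕ) (m : ℤ), F^[n] s + m ∈ Set.Ioo a b := by
  have hmeet : ∀ c d : ℝ, c < d → ∀ N : ℕ, ∃ r > N, ∃ y ∈ Set.Ioo c d, f^[r] x = (y : S1) := by
    intro c d hcd N
    obtain ⟨r, ⟨y, hy, hyr⟩, hr⟩ := (infinite_setOf_iterate_mem hx
      (isOpen_coe_image (isOpen_Ioo (a := c) (b := d)))
      ((Set.nonempty_Ioo.2 hcd).image _)).exists_gt N
    exact ⟨r + 1, by omega, y, hy, hyr.symm⟩
  obtain ⟨r, -, y, hy, hyr⟩ := hmeet a b hab 0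
  obtain ⟨r', hr', y', hy', hyr'⟩ := hmeet a y hy.1 r
  obtain ⟨n, rfl⟩ := Nat.exists_eq_add_of_lt hr'
  have e : f^[r + n + 1] x = f^[n + 1] (f^[r] x) := by
    rw [← Function.iterate_add_apply, show n + 1 + r = r + n + 1 by ring]
  rw [e, hyr, (hF.iterate (n + 1)).map_coe] at hyr'
  obtain ⟨m, hm⟩ := coe_eq_coe_iff_add_int.1 hyr'
  have hH := (hF.iterate (n + 1)).add_int m
  have hs : y ≤ s + ⌈y - s⌉ := by linarith [Int.le_ceil (y - s)]
  obtain ⟨j, hj1, hj2⟩ := exists_iterate_mem_Ico_of_gt (H := fun t => F^[n + 1] t + m)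
    hH.strictMono hH.continuous (hF.iterate_add_int_ne hx n.succ_ne_zero m)
    (by rw [hm]; exact hy'.2) hs
  have hlift : ((fun t => F^[n + 1] t + m)^[j] (s + ⌈y - s⌉) : S1) =
      ((F^[(n + 1) * j] s : ℝ) : S1) := by
    rw [← (hH.iterate j).map_coe, ← Function.iterate_mul, ← (hF.iterate _).map_coe]
    congr 1
    exact (coe_eq_coe_iff_add_int.2 ⟨_, rfl⟩).symm
  obtain ⟨l, hl⟩ := coe_eq_coe_iff_add_int.1 hlift.symm
  refine ⟨(n + 1) * j, l, ?_⟩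
  rw [hl]
  rw [hm] at hj1
  exact ⟨hy'.1.trans_le hj1, hj2.trans hy.2⟩

end DenseOrbit

/-- If the inverses of the iterates of a surjective self-map of a compact space have a common
modulus of continuity, then a modulus for the map itself is explicit in it. -/
theorem dist_lt_of_iterate_modulus {X : Type*} [PseudoMetricSpace X] [CompactSpace X]
    {g : X → X} (hg : Function.Surjective g) {ε δ η : ℝ} (hη : 0 < η)
    (hδ : ∀ (n : ℕ) (x y : X), dist (g^[n] x) (g^[n] y) < δ → dist x y < ε / 3)
    (hηδ : ∀ (n : ℕ) (x y : X), dist (g^[n] x) (g^[n] y) < η → dist x y < δ)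
    {x y : X} (hxy : dist x y < δ) : dist (g x) (g y) < ε := by
  obtain ⟨a, φ, hφ, ha⟩ := CompactSpace.tendsto_subseq fun n : ℕ => (g^[n] x, g^[n] y)
  have hcauchy := ha.cauchySeq
  rw [Metric.cauchySeq_iff] at hcauchy
  obtain ⟨N, hN⟩ := hcauchy η hη
  have hd := hN N le_rfl (N + 1) (by omega)
  obtain ⟨l, hl⟩ := Nat.exists_eq_add_of_lt (hφ (Nat.lt_succ_self N))
  simp only [Function.comp_apply] at hd
  rw [show φ (N + 1) = φ N + (l + 1) by omega, Prod.dist_eq, max_lt_iff] at hd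
  simp only [Function.iterate_add_apply g (φ N)] at hd
  have hx := hηδ _ _ _ hd.1
  have hy := hηδ _ _ _ hd.2
  obtain ⟨x', rfl⟩ := hg.iterate l x
  obtain ⟨y', rfl⟩ := hg.iterate l y
  rw [Function.iterate_succ_apply] at hx hy
  have h1 := hδ _ _ _ hx
  have h2 := hδ _ _ _ hy
  have h3 := hδ _ _ _ hxy
  have := dist_triangle4_left x' y' (g (g^[l] x')) (g (g^[l] y'))
  linarith

section Words

variable {k : ℕ} {g : Fin k → S1 ≃ₜ S1}

theorem applyWord_append (v w : List (Fin k)) (x : S1) :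
    applyWord g (v ++ w) x = applyWord g w (applyWord g v x) := by
  simp [applyWord, List.foldl_append]

theorem applyWord_replicate (i : Fin k) (n : ℕ) :
    applyWord g (List.replicate n i) = (g i)^[n] := by
  induction n with
  | zero => rfl
  | succ n ih =>
    funext x
    rw [Function.iterate_succ_apply, ← ih]
    rfl

theorem exists_applyWord_eq_iterate (w : List (Fin k)) (n : ℕ) :
    ∃ v, applyWord g v = (applyWord g w)^[n] := by
  induction n with
  | zero => exact ⟨[], rfl⟩
  | succ n ih =>
    obtain ⟨v, hv⟩ := ih
    exact ⟨w ++ v, funext fun x => by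
      rw [applyWord_append, hv, Function.iterate_succ_apply]⟩

theorem exists_isLift_applyWord (hg : ∀ i, IsOPH (g i)) (w : List (Fin k)) :
    ∃ F, IsLift F (applyWord g w) := by
  induction w with
  | nil => exact ⟨id, IsLift.refl⟩
  | cons i w ih =>
    obtain ⟨F, hF⟩ := ih
    obtain ⟨G, h1, h2, h3, h4⟩ := hg i
    exact ⟨F ∘ G, hF.comp ⟨h1, h2, h3, h4⟩⟩

/-- If no arc is contracted, arcs of length at least `ε` stay uniformly long. -/
theorem exists_pos_forall_le_lift_sub
    (h : ∀ a b : ℝ, a < b → b - a < 1 → ∃ δ > 0, ∀ w F, IsLift F (applyWord g w) → δ ≤ F b - F a)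
    {ε : ℝ} (hε : 0 < ε) :
    ∃ δ > 0, ∀ w F, IsLift F (applyWord g w) → ∀ s t, ε ≤ t - s → δ ≤ F t - F s := by
  obtain ⟨N, hN⟩ := exists_nat_gt (max 1 (2 / ε))
  have hN1 : (1 : ℝ) < N := (le_max_left _ _).trans_lt hN
  have hN0 : (0 : ℝ) < N := by linarith
  have hNε : 2 < N * ε := by
    have := (le_max_right _ _).trans_lt hN
    rwa [div_lt_iff₀ hε] at this
  have hlen : ∀ i : Fin N, ∃ δ > 0, ∀ w F, IsLift F (applyWord g w) →
      δ ≤ F (((i : ℕ) + 1 : ℝ) / N) - F ((i : ℕ) / N) := by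
    intro i
    refine h _ _ (by gcongr; linarith) ?_
    rw [← sub_div, div_lt_one hN0]
    linarith
  choose δ hδ0 hδ using hlen
  have hne : (Finset.univ : Finset (Fin N)).Nonempty :=
    ⟨⟨0, by exact_mod_cast hN0⟩, Finset.mem_univ _⟩
  refine ⟨Finset.univ.inf' hne δ, (Finset.lt_inf'_iff hne).2 fun i _ => hδ0 i, ?_⟩
  intro w F hF s t hst
  set c : ℤ := ⌈s * N⌉
  have hNz : (N : ℤ) ≠ 0 := by
    intro h0
    have : (N : ℝ) = 0 := by exact_mod_cast h0
    linarith
  have hmod0 := Int.emod_nonneg c hNz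
  have hmod1 := Int.emod_lt_of_pos c (show (0 : ℤ) < N by exact_mod_cast hN0)
  obtain ⟨i, hi⟩ := Int.eq_ofNat_of_zero_le hmod0
  have hiN : i < N := by omega
  have hdecomp : (c : ℝ) = i + N * ((c / N : ℤ) : ℝ) := by
    have := Int.emod_add_mul_ediv c N
    rw [hi] at this
    exact_mod_cast this.symm
  have e1 : (c : ℝ) / N = (i : ℝ) / N + ((c / N : ℤ) : ℝ) := by
    rw [hdecomp]; field_simp
  have e2 : ((c : ℝ) + 1) / N = ((i : ℝ) + 1) / N + ((c / N : ℤ) : ℝ) := by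
    rw [hdecomp]; field_simp; ring
  have hl := Int.le_ceil (s * N)
  have hu := Int.ceil_lt_add_one (s * N)
  have hs : s ≤ (c : ℝ) / N := by rwa [le_div_iff₀ hN0]
  have ht : ((c : ℝ) + 1) / N ≤ t := by
    rw [div_le_iff₀ hN0]
    nlinarith
  have f1 := hF.strictMono.monotone hs
  have f2 := hF.strictMono.monotone ht
  rw [e1, hF.map_add_int] at f1
  rw [e2, hF.map_add_int] at f2
  have f3 := hδ ⟨i, hiN⟩ w F hF
  have f4 : Finset.univ.inf' hne δ ≤ δ ⟨i, hiN⟩ := Finset.inf'_le _ (Finset.mem_univ _)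
  simp only at f3
  linarith

/-- If no arc is contracted, the inverse family is uniformly equicontinuous. -/
theorem exists_inverse_modulus (hg : ∀ i, IsOPH (g i))
    (h : ∀ a b : ℝ, a < b → b - a < 1 → ∃ δ > 0, ∀ w F, IsLift F (applyWord g w) → δ ≤ F b - F a)
    {ε : ℝ} (hε : 0 < ε) :
    ∃ δ > 0, ∀ w x y, dist (applyWord g w x) (applyWord g w y) < δ → dist x y < ε := by
  obtain ⟨δ, hδ0, hδ⟩ := exists_pos_forall_le_lift_sub h hε
  refine ⟨δ, hδ0, fun w x y => ?_⟩
  contrapose!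
  intro hxy
  obtain ⟨F, hF⟩ := exists_isLift_applyWord hg w
  obtain ⟨s, rfl⟩ := QuotientAddGroup.mk_surjective x
  obtain ⟨t₀, rfl⟩ := QuotientAddGroup.mk_surjective y
  obtain ⟨t, ht, ht0, ht1⟩ : ∃ t : ℝ, (t : S1) = (t₀ : S1) ∧ s ≤ t ∧ t < s + 1 := by
    refine ⟨t₀ + ((-⌊t₀ - s⌋ : ℤ) : ℝ), (coe_eq_coe_iff_add_int.2 ⟨_, rfl⟩).symm, ?_, ?_⟩
    · push_cast; linarith [Int.floor_le (t₀ - s)]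
    · push_cast; linarith [Int.lt_floor_add_one (t₀ - s)]
  change ε ≤ dist (s : S1) (t₀ : S1) at hxy
  change δ ≤ dist (applyWord g w (s : S1)) (applyWord g w (t₀ : S1))
  rw [← ht] at hxy ⊢
  have d1 : ε ≤ t - s := by
    rw [dist_comm, dist_eq_norm, ← AddCircle.coe_sub] at hxy
    exact hxy.trans ((norm_coe_le_abs _).trans (abs_of_nonneg (by linarith)).le)
  have d2 : ε ≤ s + 1 - t := by
    have : ((s + 1 : ℝ) : S1) = s := (coe_eq_coe_iff_add_int.2 ⟨1, by simp⟩).symm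
    rw [← this, dist_eq_norm, ← AddCircle.coe_sub] at hxy
    exact hxy.trans ((norm_coe_le_abs _).trans (abs_of_nonneg (by linarith)).le)
  have f1 := hδ w F hF _ _ d1
  have f2 := hδ w F hF _ _ d2
  rw [hF.map_add_one] at f2
  rw [hF.map_coe, hF.map_coe, dist_comm, dist_eq_norm, ← AddCircle.coe_sub, UnitAddCircle.norm_eq]
  set m := round (F t - F s)
  rcases le_or_gt m 0 with hm | hm
  · have : (m : ℝ) ≤ 0 := by exact_mod_cast hm
    exact le_trans (by linarith) (le_abs_self _)
  · have : (1 : ℝ) ≤ m := by exact_mod_cast hm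
    exact le_trans (by linarith) (neg_le_abs _)

theorem equicontinuous_of_not_contracting (hg : ∀ i, IsOPH (g i))
    (h : ∀ a b : ℝ, a < b → b - a < 1 →
      ∃ δ > 0, ∀ w F, IsLift F (applyWord g w) → δ ≤ F b - F a) :
    Equicontinuous fun w : List (Fin k) => applyWord g w := by
  refine UniformEquicontinuous.equicontinuous (Metric.uniformEquicontinuous_iff.2 fun ε hε => ?_)
  obtain ⟨δ, hδ0, hδ⟩ := exists_inverse_modulus hg h (show 0 < ε / 3 by linarith)
  obtain ⟨η, hη0, hη⟩ := exists_inverse_modulus hg h hδ0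
  refine ⟨δ, hδ0, fun x y hxy w => ?_⟩
  obtain ⟨F, hF⟩ := exists_isLift_applyWord hg w
  refine dist_lt_of_iterate_modulus hF.map_surjective hη0 (fun n x y => ?_) (fun n x y => ?_) hxy
  · obtain ⟨v, hv⟩ := exists_applyWord_eq_iterate (g := g) w n
    rw [← hv]
    exact hδ v x y
  · obtain ⟨v, hv⟩ := exists_applyWord_eq_iterate (g := g) w n
    rw [← hv]
    exact hη v x y

theorem contractive_of_contracting_arc (hg : ∀ i, IsOPH (g i)) (hadm : Admissible g) {a b : ℝ}
    (hab : a < b) (hab1 : b - a < 1)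
    (h : ∀ δ > 0, ∃ w F, IsLift F (applyWord g w) ∧ F b - F a < δ) : Contractive g := by
  intro x
  obtain ⟨i, x₀, hx₀⟩ := hadm
  obtain ⟨G, h1, h2, h3, h4⟩ := hg i
  have hG : IsLift G (g i) := ⟨h1, h2, h3, h4⟩
  obtain ⟨s, rfl⟩ := QuotientAddGroup.mk_surjective x
  obtain ⟨n, m, hs⟩ := hG.exists_iterate_mem hx₀ hab s
  have hH := (hG.iterate n).add_int m
  set H : ℝ → ℝ := fun t => G^[n] t + m
  obtain ⟨a', rfl⟩ := hH.surjective a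
  obtain ⟨b', rfl⟩ := hH.surjective b
  choose w F hF hw using fun j : ℕ => h (1 / ((j : ℝ) + 1)) Nat.one_div_pos_of_nat
  refine ⟨a', b', hH.strictMono.lt_iff_lt.1 hab, ?_, ⟨s, ⟨hH.strictMono.lt_iff_lt.1 hs.1,
    hH.strictMono.lt_iff_lt.1 hs.2⟩, rfl⟩, fun j => List.replicate n i ++ w j, ?_⟩
  · have := hH.map_add_one a'
    have : b' < a' + 1 := hH.strictMono.lt_iff_lt.1 (by linarith)
    linarith
  · have hlim : Tendsto (fun j : ℕ => ENNReal.ofReal (1 / ((j : ℝ) + 1))) atTop (𝓝 0) := by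
      simpa using ENNReal.tendsto_ofReal tendsto_one_div_add_atTop_nhds_zero_nat
    refine tendsto_of_tendsto_of_tendsto_of_le_of_le tendsto_const_nhds hlim
      (fun _ => zero_le) fun j => ?_
    refine (measure_mono ?_).trans ((volume_coe_image_Ioo_le (F j (H a')) (F j (H b'))).trans
      (ENNReal.ofReal_le_ofReal (hw j).le))
    rintro _ ⟨_, ⟨t, ht, rfl⟩, rfl⟩
    refine ⟨F j (H t), ⟨(hF j).strictMono (hH.strictMono ht.1),
      (hF j).strictMono (hH.strictMono ht.2)⟩, ?_⟩
    simp only [applyWord_append, applyWord_replicate, hH.map_coe, (hF j).map_coe]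

end Words

/-- The action of an admissible family of orientation-preserving circle
homeomorphisms is either equicontinuous or contractive. -/
theorem admissible_equicontinuous_or_contractive {k : ℕ} (g : Fin k → S1 ≃ₜ S1)
    (hg : ∀ i, IsOPH (g i)) (hadm : Admissible g) :
    Equicontinuous (fun w : List (Fin k) => applyWord g w) ∨ Contractive g := by
  by_cases h : ∀ a b : ℝ, a < b → b - a < 1 →
      ∃ δ > 0, ∀ w F, IsLift F (applyWord g w) → δ ≤ F b - F a
  · exact Or.inl (equicontinuous_of_not_contracting hg h)
  · push Not at h
    obtain ⟨a, b, hab, hab1, h⟩ := h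
    exact Or.inr (contractive_of_contracting_arc hg hadm hab hab1 h)
end
end

section
/- Let Γ={g₁,…,g_k} be a finite admissible set of orientation-preserving circle homeomorphisms and let p=(p₁,…,p_k) be a probability vector with all pᵢ>0. Then the Markov operator P corresponding to (Γ,p) admits exactly one invariant Borel probability measure, i.e., there is a unique Borel probability measure μ* on S¹ with Pμ*=μ*. -/
open MeasureTheory Filter Topology

noncomputable section

lemma isProbabilityMeasure_markovP {k : ℕ} {p : Fin k → ℝ} (hp : ∀ i, 0 < p i)
    (hsum : ∑ i, p i = 1) (g : Fin k → S1 ≃ₜ S1) (μ : Measure S1) [IsProbabilityMeasure μ] :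
    IsProbabilityMeasure (markovP p g μ) := by
  have h : ∀ i, Measure.map (g i) μ Set.univ = 1 := fun i => by
    rw [Measure.map_apply (g i).continuous.measurable MeasurableSet.univ]
    simp
  constructor
  simp only [markovP, Measure.coe_finsetSum, Finset.sum_apply, Measure.smul_apply, h, smul_eq_mul,
    mul_one]
  rw [← ENNReal.ofReal_sum_of_nonneg fun i _ => (hp i).le, hsum, ENNReal.ofReal_one]

lemma markovP_iterate_isProbabilityMeasure {k : ℕ} {p : Fin k → ℝ} (hp : ∀ i, 0 < p i)
    (hsum : ∑ i, p i = 1) (g : Fin k → S1 ≃ₜ S1) (μ : Measure S1) [IsProbabilityMeasure μ]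
    (n : ℕ) : IsProbabilityMeasure ((markovP p g)^[n] μ) := by
  induction n with
  | zero => simpa
  | succ n ih =>
    rw [Function.iterate_succ_apply']
    exact isProbabilityMeasure_markovP hp hsum g _

lemma continuous_dualP {k : ℕ} (p : Fin k → ℝ) (g : Fin k → S1 ≃ₜ S1) {f : S1 → ℝ}
    (hf : Continuous f) : Continuous (dualP p g f) :=
  continuous_finsetSum _ fun i _ => continuous_const.mul (hf.comp (g i).continuous)

lemma integrable_of_continuous (μ : Measure S1) [IsFiniteMeasure μ] {f : S1 → ℝ}
    (hf : Continuous f) : Integrable f μ :=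
  hf.integrable_of_hasCompactSupport (HasCompactSupport.of_compactSpace f)

lemma integral_markovP {k : ℕ} {p : Fin k → ℝ} (hp : ∀ i, 0 < p i) (g : Fin k → S1 ≃ₜ S1)
    (μ : Measure S1) [IsFiniteMeasure μ] {f : S1 → ℝ} (hf : Continuous f) :
    ∫ x, f x ∂(markovP p g μ) = ∫ x, dualP p g f x ∂μ := by
  unfold markovP dualP
  rw [integral_finsetSum_measure, integral_finsetSum]
  · refine Finset.sum_congr rfl fun i _ => ?_
    rw [integral_smul_measure, integral_map (g i).continuous.aemeasurable
      hf.aestronglyMeasurable, integral_const_mul, ENNReal.toReal_ofReal (hp i).le, smul_eq_mul]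
  · exact fun i _ => (integrable_of_continuous μ (hf.comp (g i).continuous)).const_mul _
  · exact fun i _ => (integrable_of_continuous _ hf).smul_measure ENNReal.ofReal_ne_top

lemma abs_integral_le_of_forall_abs_le (μ : Measure S1) [IsProbabilityMeasure μ] {f : S1 → ℝ}
    {C : ℝ} (hC : ∀ x, |f x| ≤ C) : |∫ x, f x ∂μ| ≤ C := by
  simpa using norm_integral_le_of_norm_le_const (μ := μ) (f := f) (Eventually.of_forall hC)

lemma exists_forall_abs_le {f : S1 → ℝ} (hf : Continuous f) : ∃ C, ∀ x, |f x| ≤ C := by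
  obtain ⟨C, hC⟩ := isCompact_univ.exists_bound_of_continuousOn hf.continuousOn
  exact ⟨C, fun x => hC x trivial⟩

/-- Krylov–Bogolyubov: the averages of the `P`-orbit of a point mass accumulate at an
invariant measure. -/
lemma exists_invariant_measure {k : ℕ} {p : Fin k → ℝ} (hp : ∀ i, 0 < p i)
    (hsum : ∑ i, p i = 1) (g : Fin k → S1 ≃ₜ S1) :
    ∃ μ : Measure S1, IsProbabilityMeasure μ ∧ markovP p g μ = μ := by
  let δ : Measure S1 := Measure.dirac 0
  let c : ℕ → ENNReal := fun n => ((n + 1 : ℕ) : ENNReal)⁻¹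
  let Q : ℕ → Measure S1 := fun n =>
    c n • ∑ j ∈ Finset.range (n + 1), (markovP p g)^[j] δ
  have hδ := markovP_iterate_isProbabilityMeasure hp hsum g δ
  have hQ : ∀ n, IsProbabilityMeasure (Q n) := fun n => by
    constructor
    simp only [Q, c, Measure.smul_apply, Measure.coe_finsetSum, Finset.sum_apply, measure_univ,
      Finset.sum_const, Finset.card_range, smul_eq_mul, nsmul_eq_mul, mul_one]
    exact ENNReal.inv_mul_cancel (by simp) (ENNReal.natCast_ne_top _)
  have hint : ∀ f : S1 → ℝ, Continuous f → ∀ n, ∫ x, f x ∂(Q n) =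
      birkhoffAverage ℝ (markovP p g) (fun μ => ∫ x, f x ∂μ) (n + 1) δ := fun f hf n => by
    simp only [Q, c, birkhoffAverage, birkhoffSum]
    rw [integral_smul_measure, integral_finsetSum_measure
      fun i _ => integrable_of_continuous _ hf, ENNReal.toReal_inv, ENNReal.toReal_natCast]
  let R : ℕ → ProbabilityMeasure S1 := fun n => ⟨Q n, hQ n⟩
  let U : Ultrafilter ℕ := hyperfilter ℕ
  have hU : (U : Filter ℕ) ≤ atTop := Nat.hyperfilter_le_atTop
  obtain ⟨μ, -, hμ⟩ := (isCompact_univ (X := ProbabilityMeasure S1)).ultrafilter_le_nhds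
    (U.map R) (by simp)
  have hlim : ∀ f : S1 → ℝ, Continuous f →
      Tendsto (fun n => ∫ x, f x ∂(Q n)) U (𝓝 (∫ x, f x ∂(μ : Measure S1))) := fun f hf => by
    exact ProbabilityMeasure.tendsto_iff_forall_integral_tendsto.1 (show Tendsto R U (𝓝 μ) from hμ)
      (BoundedContinuousFunction.mkOfCompact ⟨f, hf⟩)
  have := isProbabilityMeasure_markovP hp hsum g (μ : Measure S1)
  refine ⟨μ, inferInstance, ?_⟩
  refine ext_of_forall_integral_eq_of_IsFiniteMeasure fun f => ?_
  rw [integral_markovP hp g _ f.continuous]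
  refine tendsto_nhds_unique (hlim _ (continuous_dualP p g f.continuous)) ?_
  have hdiff : Tendsto (fun n => ∫ x, dualP p g f x ∂(Q n) - ∫ x, f x ∂(Q n)) U (𝓝 0) := by
    have hb : Bornology.IsBounded
        (Set.range fun j => (fun μ : Measure S1 => ∫ x, f x ∂μ) ((markovP p g)^[j] δ)) := by
      obtain ⟨C, hC⟩ := exists_forall_abs_le f.continuous
      refine (isBounded_iff_forall_norm_le).2 ⟨C, ?_⟩
      rintro _ ⟨j, rfl⟩
      exact abs_integral_le_of_forall_abs_le _ hC
    refine Tendsto.congr (fun n => ?_) (((tendsto_birkhoffAverage_apply_sub_birkhoffAverage ℝ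
      (f := markovP p g) (g := fun μ : Measure S1 => ∫ x, f x ∂μ) (x := δ) hb).comp
      (tendsto_add_atTop_nat 1)).mono_left hU)
    rw [hint _ f.continuous, hint _ (continuous_dualP p g f.continuous)]
    simp only [Function.comp_apply, birkhoffAverage, birkhoffSum]
    congr 2
    refine Finset.sum_congr rfl fun j _ => ?_
    rw [← Function.iterate_succ_apply, Function.iterate_succ_apply',
      integral_markovP hp g _ f.continuous]
  simpa using hdiff.add (hlim f f.continuous)

/-- `G` is a lift of the circle homeomorphism `h` to the real line. -/
structure IsLift_s2 (G : ℝ → ℝ) (h : S1 ≃ₜ S1) : Prop where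
  strictMono : StrictMono G
  continuous : Continuous G
  map_add_one : ∀ t, G (t + 1) = G t + 1
  apply_coe : ∀ t : ℝ, h (t : S1) = (G t : S1)

lemma coe_eq_coe_iff {s t : ℝ} : (s : S1) = (t : S1) ↔ ∃ m : ℤ, t = s + m := by
  rw [eq_comm, QuotientAddGroup.eq_iff_sub_mem, AddSubgroup.mem_zmultiples_iff]
  refine exists_congr fun m => ?_
  rw [zsmul_one]
  constructor <;> intro h <;> linarith

lemma coe_add_intCast (t : ℝ) (m : ℤ) : ((t + m : ℝ) : S1) = (t : S1) :=
  (coe_eq_coe_iff.2 ⟨m, rfl⟩).symm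

instance : Uncountable S1 := by
  have : Uncountable (Set.Ico (0 : ℝ) (0 + 1)) := by
    rw [← Cardinal.aleph0_lt_mk_iff, Cardinal.mk_Ico_real (by norm_num)]
    exact Cardinal.aleph0_lt_continuum
  exact (AddCircle.equivIco (1 : ℝ) 0).symm.injective.uncountable

namespace IsLift_s2

variable {G : ℝ → ℝ} {h : S1 ≃ₜ S1}

lemma map_add_int_s2 (hG : IsLift_s2 G h) (t : ℝ) (m : ℤ) : G (t + m) = G t + m := by
  induction m using Int.induction_on with
  | zero => simp
  | succ n ih =>
    push_cast at ih ⊢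
    rw [← add_assoc, hG.map_add_one, ih, add_assoc]
  | pred n ih =>
    have := hG.map_add_one (t + ((-n - 1 : ℤ) : ℝ))
    have e : t + ((-n - 1 : ℤ) : ℝ) + 1 = t + ((-n : ℤ) : ℝ) := by push_cast; ring
    rw [e, ih] at this
    push_cast at this ⊢
    linarith

lemma surjective_s2 (hG : IsLift_s2 G h) : Function.Surjective G := by
  intro y
  obtain ⟨m, hm⟩ := exists_int_lt (y - G 0)
  obtain ⟨n, hn⟩ := exists_int_gt (y - G 0)
  have h1 := hG.map_add_int_s2 0 m
  have h2 := hG.map_add_int_s2 0 n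
  exact mem_range_of_exists_le_of_exists_ge hG.continuous
    ⟨_, (by rw [h1]; linarith : G (0 + m) ≤ y)⟩ ⟨_, (by rw [h2]; linarith : y ≤ G (0 + n))⟩

/-- The lift `t ↦ Gʲ t + m` of the `j`-th iterate of `h`. -/
lemma iterate_coe (hG : IsLift_s2 G h) (j : ℕ) (m : ℤ) (t : ℝ) :
    ((G^[j] t + m : ℝ) : S1) = h^[j] (t : S1) := by
  rw [coe_add_intCast]
  induction j with
  | zero => rfl
  | succ j ih => rw [Function.iterate_succ_apply', Function.iterate_succ_apply', ← ih, hG.apply_coe]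

lemma iterate_add_int (hG : IsLift_s2 G h) (j : ℕ) (t : ℝ) (m : ℤ) :
    G^[j] (t + m) = G^[j] t + m := by
  induction j with
  | zero => rfl
  | succ j ih => rw [Function.iterate_succ_apply', Function.iterate_succ_apply', ih, hG.map_add_int_s2]

/-- The closure of an orbit of a circle homeomorphism with a periodic point is countable,
so that the orbit is not dense. -/
lemma iterate_add_int_ne_self (hG : IsLift_s2 G h) {x : S1}
    (hx : Dense (Set.range fun n : ℕ => h^[n + 1] x)) {q : ℕ} (hq : 0 < q) (m : ℤ) (t : ℝ) :
    G^[q] t + m ≠ t := by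
  intro ht
  let H : ℝ → ℝ := fun s => G^[q] s + m
  have hHmono : StrictMono H := fun a b hab => by
    simpa [H] using hG.strictMono.iterate q hab
  have hHadd : ∀ (s : ℝ) (n : ℤ), H (s + n) = H s + n := fun s n => by
    simp only [H, hG.iterate_add_int]; ring
  obtain ⟨s, rfl⟩ := QuotientAddGroup.mk_surjective x
  have hHcoe : ∀ j, ((H^[j] s : ℝ) : S1) = (h^[q])^[j] (s : S1) := fun j => by
    induction j with
    | zero => rfl
    | succ j ih =>
      rw [Function.iterate_succ_apply', Function.iterate_succ_apply', ← ih, hG.iterate_coe]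
  have hfix : ∀ n : ℤ, Function.IsFixedPt H (t + n) := fun n => by
    show H (t + n) = t + n
    rw [hHadd]; exact congrArg (· + (n : ℝ)) ht
  obtain ⟨l, hl⟩ := exists_int_lt (s - t)
  obtain ⟨u, hu⟩ := exists_int_gt (s - t)
  have hlow : ∀ j, t + l ≤ H^[j] s := fun j => by
    have := (hHmono.monotone.iterate j) (show t + l ≤ s by linarith)
    rwa [((hfix l).iterate j).eq] at this
  have hupp : ∀ j, H^[j] s ≤ t + u := fun j => by
    have := (hHmono.monotone.iterate j) (show s ≤ t + u by linarith)
    rwa [((hfix u).iterate j).eq] at this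
  have hlim : ∃ L, Tendsto (fun j => H^[j] s) atTop (𝓝 L) := by
    rcases le_total s (H s) with hs | hs
    · exact ⟨_, tendsto_atTop_ciSup (hHmono.monotone.monotone_iterate_of_le_map hs)
        ⟨_, Set.forall_mem_range.2 hupp⟩⟩
    · exact ⟨_, tendsto_atTop_ciInf (hHmono.monotone.antitone_iterate_of_map_le hs)
        ⟨_, Set.forall_mem_range.2 hlow⟩⟩
  obtain ⟨L, hL⟩ := hlim
  let C : Set S1 := ⋃ r ∈ Finset.range q,
    h^[r] '' ((fun t : ℝ => (t : S1)) '' insert L (Set.range fun j => H^[j] s))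
  have hCclosed : IsClosed C := by
    refine isClosed_biUnion_finset fun r _ => IsCompact.isClosed ?_
    exact (hL.isCompact_insert_range.image (AddCircle.continuous_mk' 1)).image
      (h.continuous.iterate r)
  have hCcount : C.Countable := by
    refine (Finset.countable_toSet _).biUnion fun r _ => ?_
    exact (((Set.countable_range _).insert L).image _).image _
  have hsub : Set.range (fun n : ℕ => h^[n + 1] (s : S1)) ⊆ C := by
    rintro _ ⟨n, rfl⟩
    refine Set.mem_biUnion (x := (n + 1) % q)
      (Finset.mem_coe.2 (Finset.mem_range.2 (Nat.mod_lt _ hq))) ?_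
    refine ⟨_, ⟨_, Or.inr ⟨(n + 1) / q, rfl⟩, rfl⟩, ?_⟩
    simp only [hHcoe]
    rw [← Function.iterate_mul, ← Function.iterate_add_apply, Nat.mod_add_div]
  have huniv : C = Set.univ := by
    rw [← hCclosed.closure_eq]
    exact (hx.mono hsub).closure_eq
  exact Set.not_countable_univ (huniv ▸ hCcount)

end IsLift_s2

/-- A circle homeomorphism with a dense forward orbit has no proper nonempty closed subset that
is forward or backward invariant. -/
lemma eq_univ_of_isClosed_of_invariant {h : S1 ≃ₜ S1} (hh : IsOPH h) {x : S1}
    (hx : Dense (Set.range fun n : ℕ => h^[n + 1] x)) {K : Set S1} (hK : IsClosed K)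
    (hne : K.Nonempty) (hinv : (∀ z ∈ K, h z ∈ K) ∨ ∀ z, h z ∈ K → z ∈ K) : K = Set.univ := by
  obtain ⟨G, hG⟩ := hh
  replace hG : IsLift_s2 G h := ⟨hG.1, hG.2.1, hG.2.2.1, hG.2.2.2⟩
  let π : ℝ → S1 := fun t => (t : S1)
  have hπ : Continuous π := AddCircle.continuous_mk' 1
  have hKcl : IsClosed (π ⁻¹' K) := hK.preimage hπ
  have hKadd : ∀ (t : ℝ) (m : ℤ), π t ∈ K → π (t + m) ∈ K := fun t m ht => by
    simpa only [π, coe_add_intCast] using ht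
  by_contra hKuniv
  obtain ⟨y', hy'⟩ := (Set.ne_univ_iff_exists_notMem K).1 hKuniv
  obtain ⟨y, rfl⟩ := QuotientAddGroup.mk_surjective y'
  obtain ⟨z', hz'⟩ := hne
  obtain ⟨z, rfl⟩ := QuotientAddGroup.mk_surjective z'
  obtain ⟨l, hl⟩ := exists_int_lt (y - z)
  obtain ⟨u, hu⟩ := exists_int_gt (y - z)
  obtain ⟨a, ⟨haK, hay⟩, ha⟩ : ∃ a, IsGreatest (π ⁻¹' K ∩ Set.Iic y) a :=
    ⟨_, (hKcl.inter isClosed_Iic).isGreatest_csSup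
      ⟨z + l, hKadd _ _ hz', (by linarith : z + l ≤ y)⟩ ⟨y, fun _ h => h.2⟩⟩
  obtain ⟨b, ⟨hbK, hyb⟩, hb⟩ : ∃ b, IsLeast (π ⁻¹' K ∩ Set.Ici y) b :=
    ⟨_, (hKcl.inter isClosed_Ici).isLeast_csInf
      ⟨z + u, hKadd _ _ hz', (by linarith : y ≤ z + u)⟩ ⟨y, fun _ h => h.2⟩⟩
  replace hay : a < y := lt_of_le_of_ne hay fun e => hy' (e ▸ haK)
  replace hyb : y < b := lt_of_le_of_ne hyb fun e => hy' (e ▸ hbK)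
  have hleft : ∀ t, π t ∈ K → t < b → t ≤ a := fun t ht htb =>
    ha ⟨ht, Set.mem_Iic.2 <| le_of_not_ge fun h => absurd (hb ⟨ht, h⟩) (not_le.2 htb)⟩
  have hright : ∀ t, π t ∈ K → a < t → b ≤ t := fun t ht hta =>
    hb ⟨ht, Set.mem_Ici.2 <| le_of_not_ge fun h => absurd (ha ⟨ht, h⟩) (not_le.2 hta)⟩
  have hD : Dense (π ⁻¹' Set.range fun n : ℕ => h^[n + 1] x) :=
    hx.preimage QuotientAddGroup.isOpenMap_coe
  obtain ⟨s, hsD, hs⟩ := hD.exists_between (hay.trans hyb)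
  obtain ⟨t, htD, ht⟩ := hD.exists_between hs.1
  -- Two distinct points of the gap `(a, b)` related by a lift of an iterate of `h`
  have key : ∀ s t : ℝ, s ∈ Set.Ioo a b → t ∈ Set.Ioo a b → s ≠ t → ∀ j : ℕ,
      h^[j] (s : S1) = (t : S1) → False := by
    intro s t hs ht hst j hj
    rw [← hG.iterate_coe j 0 s, coe_eq_coe_iff] at hj
    obtain ⟨m, hm⟩ := hj
    let H : ℝ → ℝ := fun r => G^[j] r + m
    have hHmono : StrictMono H := fun a b hab => by simpa [H] using hG.strictMono.iterate j hab
    have hHcont : Continuous H := (hG.continuous.iterate j).add continuous_const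
    have hHs : H s = t := by rw [hm]; simp [H]
    have hfix : ∃ r, H r = r := by
      rcases hinv with hinv | hinv
      · have hHK : ∀ r, π r ∈ K → π (H r) ∈ K := fun r hr => by
          simp only [π, H, hG.iterate_coe]
          exact Set.MapsTo.iterate (fun z hz => hinv z hz) j hr
        have h1 : H a ≤ a := hleft _ (hHK a haK) ((hHmono hs.1).trans (hHs ▸ ht.2))
        have h2 : b ≤ H b := hright _ (hHK b hbK) (lt_trans (hHs ▸ ht.1) (hHmono hs.2))
        obtain ⟨r, -, hr⟩ := isPreconnected_univ.intermediate_value₂ (Set.mem_univ a)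
          (Set.mem_univ b) hHcont.continuousOn continuousOn_id h1 h2
        exact ⟨r, hr⟩
      · have hHsurj : Function.Surjective H := fun r => by
          obtain ⟨r', hr'⟩ := hG.surjective_s2.iterate j (r - m)
          exact ⟨r', by simp [H, hr']⟩
        have hHK : ∀ r, π (H r) ∈ K → π r ∈ K := fun r hr => by
          simp only [π, H, hG.iterate_coe] at hr ⊢
          by_contra hcon
          exact Set.MapsTo.iterate (s := Kᶜ) (fun z hz hz' => hz (hinv z hz')) j hcon hr
        obtain ⟨a', ha'⟩ := hHsurj a
        obtain ⟨b', hb'⟩ := hHsurj b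
        have h1 : a' < s := hHmono.lt_iff_lt.1 (by rw [ha', hHs]; exact ht.1)
        have h2 : s < b' := hHmono.lt_iff_lt.1 (by rw [hb', hHs]; exact ht.2)
        have h3 : a' ≤ a := hleft _ (hHK a' (by rwa [ha'])) (h1.trans hs.2)
        have h4 : b ≤ b' := hright _ (hHK b' (by rwa [hb'])) (hs.1.trans h2)
        obtain ⟨r, -, hr⟩ := isPreconnected_univ.intermediate_value₂ (Set.mem_univ b')
          (Set.mem_univ a') hHcont.continuousOn continuousOn_id
          (show H b' ≤ b' by rw [hb']; exact h4) (show a' ≤ H a' by rw [ha']; exact h3)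
        exact ⟨r, hr⟩
    obtain ⟨r, hr⟩ := hfix
    rcases Nat.eq_zero_or_pos j with rfl | hjpos
    · refine hst ?_
      have hr' : r + m = r := hr
      rw [hm, show (m : ℝ) = 0 by linarith]
      simp
    · exact hG.iterate_add_int_ne_self hx hjpos m r hr
  obtain ⟨n₁, hn₁⟩ := hsD
  obtain ⟨n₂, hn₂⟩ := htD
  have ht' : t ∈ Set.Ioo a b := ⟨ht.1, ht.2.trans hs.2⟩
  simp only [π] at hn₁ hn₂
  rcases le_total n₁ n₂ with hle | hle
  · refine key s t hs ht' ht.2.ne' (n₂ - n₁) ?_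
    rw [← hn₁, ← hn₂, ← Function.iterate_add_apply,
      show n₂ - n₁ + (n₁ + 1) = n₂ + 1 by omega]
  · refine key t s ht' hs ht.2.ne (n₁ - n₂) ?_
    rw [← hn₁, ← hn₂, ← Function.iterate_add_apply,
      show n₁ - n₂ + (n₂ + 1) = n₁ + 1 by omega]

lemma markovP_symm_apply {k : ℕ} (p : Fin k → ℝ) (g : Fin k → S1 ≃ₜ S1) (ν : Measure S1)
    (A : Set S1) :
    markovP p (fun i => (g i).symm) ν A = ∑ i, ENNReal.ofReal (p i) * ν (g i '' A) := by
  have h : ∀ i, Measure.map (g i).symm ν A = ν (g i '' A) := fun i => by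
    rw [show (g i '' A) = (g i).symm ⁻¹' A from (g i).toEquiv.image_eq_preimage_symm A]
    exact (g i).symm.toMeasurableEquiv.map_apply A
  simp only [markovP, Measure.coe_finsetSum, Finset.sum_apply, Measure.smul_apply, h, smul_eq_mul]

section InverseStationary

variable {k : ℕ} {g : Fin k → S1 ≃ₜ S1} {p : Fin k → ℝ} {ν : Measure S1}

lemma sum_mul_measureReal_image (hp : ∀ i, 0 < p i) [IsFiniteMeasure ν]
    (hν : markovP p (fun i => (g i).symm) ν = ν) (A : Set S1) :
    ∑ i, p i * ν.real (g i '' A) = ν.real A := by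
  conv_rhs => rw [Measure.real, ← hν, markovP_symm_apply]
  rw [ENNReal.toReal_sum fun i _ => ENNReal.mul_ne_top ENNReal.ofReal_ne_top (measure_ne_top _ _)]
  simp [Measure.real, ENNReal.toReal_ofReal (hp _).le]

/-- In a convex combination attaining an upper bound, every term attains it. -/
lemma eq_of_sum_mul_eq {a : Fin k → ℝ} {M : ℝ} (hp : ∀ i, 0 < p i) (hsum : ∑ i, p i = 1)
    (ha : ∀ i, a i ≤ M) (h : ∑ i, p i * a i = M) (i : Fin k) : a i = M := by
  have h' : ∑ i, p i * a i = ∑ i, p i * M := by rw [h, ← Finset.sum_mul, hsum, one_mul]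
  have := (Finset.sum_eq_sum_iff_of_le fun i _ =>
    mul_le_mul_of_nonneg_left (ha i) (hp i).le).1 h' i (Finset.mem_univ i)
  exact mul_left_cancel₀ (hp i).ne' this

lemma isOpenPosMeasure_of_invariant (hg : ∀ i, IsOPH (g i)) (hadm : Admissible g)
    (hp : ∀ i, 0 < p i) [IsProbabilityMeasure ν]
    (hν : markovP p (fun i => (g i).symm) ν = ν) : ν.IsOpenPosMeasure := by
  obtain ⟨i, x, hx⟩ := hadm
  have huniv : ν.support = Set.univ := by
    refine eq_univ_of_isClosed_of_invariant (hg i) hx Measure.isClosed_support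
      (Measure.nonempty_support (IsProbabilityMeasure.ne_zero ν)) (Or.inr fun z hz => ?_)
    rw [Measure.mem_support_iff_forall] at hz ⊢
    intro U hU
    have hpos := hz (g i '' U) ((g i).isOpenMap.image_mem_nhds hU)
    rw [← hν, markovP_symm_apply]
    exact (ENNReal.mul_pos (by simpa using hp i) hpos.ne').trans_le
      (Finset.single_le_sum (f := fun i => ENNReal.ofReal (p i) * ν (g i '' U))
        (fun _ _ => zero_le) (Finset.mem_univ i))
  refine ⟨fun U hU ⟨z, hz⟩ => ?_⟩
  have : z ∈ ν.support := huniv ▸ Set.mem_univ z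
  exact ((Measure.mem_support_iff_forall z).1 this U (hU.mem_nhds hz)).ne'

lemma measure_singleton_of_invariant (hg : ∀ i, IsOPH (g i)) (hadm : Admissible g)
    (hp : ∀ i, 0 < p i) (hsum : ∑ i, p i = 1) [IsProbabilityMeasure ν]
    (hν : markovP p (fun i => (g i).symm) ν = ν) (x₀ : S1) : ν.real {x₀} = 0 := by
  by_contra hne
  have hpos : 0 < ν.real {x₀} := lt_of_le_of_ne measureReal_nonneg (Ne.symm hne)
  have hfin : {x : S1 | ν.real {x₀} ≤ ν.real {x}}.Finite := by
    have := Measure.finite_const_le_meas_of_disjoint_iUnion ν (ε := ν {x₀})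
      (As := fun x : S1 => {x}) (pos_iff_ne_zero.2 fun h => hne (by simp [Measure.real, h]))
      (fun x => measurableSet_singleton x)
      (fun x y hxy => by simpa using hxy) (measure_ne_top _ _)
    refine this.subset fun x hx => ?_
    exact (ENNReal.toReal_le_toReal (measure_ne_top _ _) (measure_ne_top _ _)).1 hx
  obtain ⟨y, hy, hmax⟩ :=
    hfin.exists_maximalFor (fun x => ν.real {x}) _ ⟨x₀, le_refl (ν.real {x₀})⟩
  have hymax : ∀ x, ν.real {x} ≤ ν.real {y} := fun x => by
    by_contra hcon
    push Not at hcon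
    exact hcon.not_ge (hmax (le_trans hy hcon.le) hcon.le)
  let F : Set S1 := {x | ν.real {x} = ν.real {y}}
  have hFfin : F.Finite := hfin.subset fun x hx => by
    show ν.real {x₀} ≤ ν.real {x}
    rw [show ν.real {x} = ν.real {y} from hx]; exact hy
  obtain ⟨i, x, hx⟩ := hadm
  have hFuniv : F = Set.univ := by
    refine eq_univ_of_isClosed_of_invariant (hg i) hx hFfin.isClosed ⟨y, rfl⟩
      (Or.inl fun z hz => ?_)
    have h1 := sum_mul_measureReal_image hp hν {z}
    simp only [Set.image_singleton] at h1
    exact eq_of_sum_mul_eq hp hsum (fun j => hymax (g j z)) (h1.trans hz) i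
  exact Set.infinite_univ (hFuniv ▸ hFfin)

end InverseStationary

/-- The image in the circle of the interval `[a, b]`. -/
def arc (a b : ℝ) : Set S1 := (fun t : ℝ => (t : S1)) '' Set.Icc a b

lemma arc_subset {a b c d : ℝ} (h₁ : c ≤ a) (h₂ : b ≤ d) : arc a b ⊆ arc c d :=
  Set.image_mono (Set.Icc_subset_Icc h₁ h₂)

lemma IsLift_s2.arc_subset_image {G : ℝ → ℝ} {h : S1 ≃ₜ S1} (hG : IsLift_s2 G h) {a b : ℝ}
    (hab : a ≤ b) : arc (G a) (G b) ⊆ h '' arc a b := by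
  rintro _ ⟨t, ht, rfl⟩
  obtain ⟨s, hs, rfl⟩ := intermediate_value_Icc hab hG.continuous.continuousOn ht
  exact ⟨_, ⟨s, hs, rfl⟩, hG.apply_coe s⟩

/-- The oscillation of `f` along every arc is at most `ε` plus `C` times the `ν`-measure
of the arc. -/
def OscBound (ν : Measure S1) (ε C : ℝ) (f : S1 → ℝ) : Prop :=
  ∀ a b : ℝ, a ≤ b → |f (a : S1) - f (b : S1)| ≤ ε + C * ν.real (arc a b)

lemma OscBound.dualP {k : ℕ} {g : Fin k → S1 ≃ₜ S1} {p : Fin k → ℝ} {ν : Measure S1}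
    [IsFiniteMeasure ν] (hg : ∀ i, IsOPH (g i)) (hp : ∀ i, 0 < p i) (hsum : ∑ i, p i = 1)
    (hν : markovP p (fun i => (g i).symm) ν = ν) {ε C : ℝ} (hC : 0 ≤ C) {f : S1 → ℝ}
    (hf : OscBound ν ε C f) : OscBound ν ε C (dualP p g f) := by
  intro a b hab
  have hi : ∀ i, |f (g i a) - f (g i b)| ≤ ε + C * ν.real (g i '' arc a b) := fun i => by
    obtain ⟨G, hG⟩ := hg i
    replace hG : IsLift_s2 G (g i) := ⟨hG.1, hG.2.1, hG.2.2.1, hG.2.2.2⟩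
    rw [hG.apply_coe, hG.apply_coe]
    refine (hf _ _ (hG.strictMono.monotone hab)).trans ?_
    gcongr
    · exact measure_ne_top _ _
    · exact hG.arc_subset_image hab
  calc |_root_.dualP p g f a - _root_.dualP p g f b|
      = |∑ i, p i * (f (g i a) - f (g i b))| := by
        simp only [_root_.dualP, mul_sub, Finset.sum_sub_distrib]
    _ ≤ ∑ i, p i * (ε + C * ν.real (g i '' arc a b)) := by
        refine (Finset.abs_sum_le_sum_abs _ _).trans (Finset.sum_le_sum fun i _ => ?_)
        rw [abs_mul, abs_of_pos (hp i)]
        exact mul_le_mul_of_nonneg_left (hi i) (hp i).le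
    _ = (∑ i, p i) * ε + C * ∑ i, p i * ν.real (g i '' arc a b) := by
        rw [Finset.sum_mul, Finset.mul_sum, ← Finset.sum_add_distrib]
        exact Finset.sum_congr rfl fun i _ => by ring
    _ = ε + C * ν.real (arc a b) := by rw [hsum, one_mul, sum_mul_measureReal_image hp hν]

/-- Arcs of a given length have `ν`-measure bounded below. -/
lemma exists_forall_le_measureReal_arc (ν : Measure S1) [IsFiniteMeasure ν]
    [ν.IsOpenPosMeasure] {δ : ℝ} (hδ : 0 < δ) : ∃ m > 0, ∀ a : ℝ, m ≤ ν.real (arc a (a + δ)) := by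
  have hloc : ∃ m > 0, ∀ a ∈ Set.Icc (0 : ℝ) 1, m ≤ ν.real (arc a (a + δ)) := by
    refine isCompact_Icc.induction_on (p := fun s => ∃ m > 0, ∀ a ∈ s, m ≤ ν.real (arc a (a + δ)))
      ⟨1, one_pos, by simp⟩ ?_ ?_ ?_
    · rintro s t hst ⟨m, hm, h⟩
      exact ⟨m, hm, fun a ha => h a (hst ha)⟩
    · rintro s t ⟨m, hm, h⟩ ⟨m', hm', h'⟩
      refine ⟨min m m', lt_min hm hm', fun a ha => ?_⟩
      rcases ha with ha | ha
      · exact (min_le_left _ _).trans (h a ha)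
      · exact (min_le_right _ _).trans (h' a ha)
    · intro a _
      refine ⟨_, mem_nhdsWithin_of_mem_nhds (Ioo_mem_nhds (a := a - δ / 4) (b := a + δ / 2)
        (by linarith) (by linarith)), ν.real (arc (a + δ / 2) (a + δ * (3 / 4))), ?_, fun c hc => ?_⟩
      · let W : Set S1 := (fun t : ℝ => (t : S1)) '' Set.Ioo (a + δ / 2) (a + δ * (3 / 4))
        have hW : IsOpen W := QuotientAddGroup.isOpenMap_coe _ isOpen_Ioo
        have hWne : W.Nonempty := (Set.nonempty_Ioo.2 (by linarith)).image _
        exact (ENNReal.toReal_pos (hW.measure_pos ν hWne).ne' (measure_ne_top _ _)).trans_le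
          (measureReal_mono (Set.image_mono Set.Ioo_subset_Icc_self))
      · exact measureReal_mono (arc_subset hc.2.le (by linarith [hc.1]))
  obtain ⟨m, hm, h⟩ := hloc
  refine ⟨m, hm, fun a => ?_⟩
  refine (h (Int.fract a) ⟨Int.fract_nonneg a, (Int.fract_lt_one a).le⟩).trans
    (measureReal_mono ?_)
  rintro _ ⟨t, ht, rfl⟩
  refine ⟨t + ⌊a⌋, ⟨?_, ?_⟩, coe_add_intCast t _⟩
  · linarith [ht.1, Int.floor_add_fract a]
  · linarith [ht.2, Int.floor_add_fract a]

lemma exists_oscBound (ν : Measure S1) [IsFiniteMeasure ν] [ν.IsOpenPosMeasure] {f : S1 → ℝ}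
    (hf : Continuous f) {ε : ℝ} (hε : 0 < ε) : ∃ C ≥ 0, OscBound ν ε C f := by
  obtain ⟨δ, hδ, hfδ⟩ := Metric.uniformContinuous_iff.1
    (CompactSpace.uniformContinuous_of_continuous hf) ε hε
  obtain ⟨M, hM⟩ := exists_forall_abs_le hf
  have hM0 : 0 ≤ M := (abs_nonneg _).trans (hM 0)
  obtain ⟨m, hm, hmarc⟩ := exists_forall_le_measureReal_arc ν hδ
  refine ⟨2 * M / m, by positivity, fun a b hab => ?_⟩
  rcases lt_or_ge (b - a) δ with hlt | hge
  · have hd : dist (a : S1) (b : S1) < δ := by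
      rw [dist_eq_norm, ← AddCircle.coe_sub]
      refine (QuotientAddGroup.norm_mk_le_norm).trans_lt ?_
      rw [Real.norm_eq_abs, abs_sub_comm, abs_of_nonneg (by linarith)]
      exact hlt
    exact (hfδ hd).le.trans (le_add_of_nonneg_right (by positivity))
  · have h1 : m ≤ ν.real (arc a b) :=
      (hmarc a).trans (measureReal_mono (arc_subset le_rfl (by linarith)))
    calc |f a - f b| ≤ |f a| + |f b| := abs_sub _ _
      _ ≤ 2 * M := by linarith [hM a, hM b]
      _ = 2 * M / m * m := by field_simp
      _ ≤ 2 * M / m * ν.real (arc a b) := by gcongr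
      _ ≤ _ := le_add_of_nonneg_left hε.le

/-- Short arcs have small measure near a point that is not an atom. -/
lemma exists_measureReal_arc_lt (ν : Measure S1) [IsFiniteMeasure ν] (s : ℝ)
    (hs : ν.real {(s : S1)} = 0) {η : ℝ} (hη : 0 < η) :
    ∃ δ > 0, ν.real (arc (s - δ) (s + δ)) < η := by
  have hs' : ν {(s : S1)} = 0 := by
    rwa [measureReal_eq_zero_iff] at hs
  obtain ⟨V, hVs, hVo, hV⟩ := Set.exists_isOpen_lt_of_lt {(s : S1)} (μ := ν) (ENNReal.ofReal η)
    (by rw [hs']; simpa using hη)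
  have hnhds : (fun t : ℝ => (t : S1)) ⁻¹' V ∈ 𝓝 s :=
    (AddCircle.continuous_mk' 1).continuousAt.preimage_mem_nhds (hVo.mem_nhds (hVs rfl))
  obtain ⟨δ, hδ, hball⟩ := Metric.nhds_basis_closedBall.mem_iff.1 hnhds
  refine ⟨δ, hδ, ?_⟩
  have hsub : arc (s - δ) (s + δ) ⊆ V := by
    rw [arc, Set.image_subset_iff, ← Real.closedBall_eq_Icc]
    exact hball
  exact (measureReal_mono hsub).trans_lt
    ((ENNReal.lt_ofReal_iff_toReal_lt (measure_ne_top _ _)).1 hV)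

lemma equicontinuous_of_oscBound {ι : Type*} (ν : Measure S1) [IsFiniteMeasure ν]
    (hν : ∀ x, ν.real {x} = 0) {F : ι → S1 → ℝ}
    (hF : ∀ ε > 0, ∃ C ≥ 0, ∀ n, OscBound ν ε C (F n)) : Equicontinuous F := by
  intro x
  obtain ⟨s, rfl⟩ := QuotientAddGroup.mk_surjective x
  rw [Metric.equicontinuousAt_iff_right]
  intro ε hε
  obtain ⟨C, hC, hosc⟩ := hF (ε / 2) (by positivity)
  obtain ⟨δ, hδ, hlt⟩ := exists_measureReal_arc_lt ν s (hν _) (η := ε / (2 * (C + 1)))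
    (by positivity)
  have hmem : (fun t : ℝ => (t : S1)) '' Set.Ioo (s - δ) (s + δ) ∈ 𝓝 (s : S1) :=
    (QuotientAddGroup.isOpenMap_coe _ isOpen_Ioo).mem_nhds
      ⟨s, ⟨by linarith, by linarith⟩, rfl⟩
  have hCε : C * (ε / (2 * (C + 1))) < ε / 2 := by
    rw [show C * (ε / (2 * (C + 1))) = ε / 2 * (C / (C + 1)) by field_simp]
    have : C / (C + 1) < 1 := (div_lt_one (by linarith)).2 (by linarith)
    nlinarith
  filter_upwards [hmem] with y hy n
  obtain ⟨t, ht, rfl⟩ := hy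
  have hsmall : ∀ a b, s - δ ≤ a → b ≤ s + δ → ε / 2 + C * ν.real (arc a b) < ε := by
    intro a b ha hb
    have : C * ν.real (arc a b) ≤ C * (ε / (2 * (C + 1))) :=
      mul_le_mul_of_nonneg_left ((measureReal_mono (arc_subset ha hb)).trans hlt.le) hC
    linarith
  rw [Real.dist_eq]
  rcases le_total s t with h | h
  · exact (hosc n s t h).trans_lt (hsmall _ _ (by linarith) ht.2.le)
  · rw [abs_sub_comm]
    exact (hosc n t s h).trans_lt (hsmall _ _ ht.1.le (by linarith))

/-- A continuous function fixed by the dual operator of an admissible system is constant. -/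
lemma eq_const_of_dualP_eq {k : ℕ} {g : Fin k → S1 ≃ₜ S1} {p : Fin k → ℝ}
    (hg : ∀ i, IsOPH (g i)) (hadm : Admissible g) (hp : ∀ i, 0 < p i) (hsum : ∑ i, p i = 1)
    {h : S1 → ℝ} (hcont : Continuous h) (hh : dualP p g h = h) : ∃ c, ∀ x, h x = c := by
  obtain ⟨i, x, hx⟩ := hadm
  obtain ⟨y, -, hy⟩ := isCompact_univ.exists_isMaxOn Set.univ_nonempty hcont.continuousOn
  have hmax : ∀ z, h z ≤ h y := fun z => hy (Set.mem_univ z)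
  have huniv : {z | h z = h y} = Set.univ := by
    refine eq_univ_of_isClosed_of_invariant (hg i) hx (isClosed_eq hcont continuous_const)
      ⟨y, rfl⟩ (Or.inl fun z hz => ?_)
    exact eq_of_sum_mul_eq hp hsum (fun j => hmax (g j z)) ((congrFun hh z).trans hz) i
  exact ⟨h y, fun z => (huniv ▸ Set.mem_univ z : z ∈ {z | h z = h y})⟩

/-- The Cesàro averages of `f` under the dual operator. -/
def cesaro {k : ℕ} (p : Fin k → ℝ) (g : Fin k → S1 ≃ₜ S1) (f : S1 → ℝ) (n : ℕ) (x : S1) : ℝ :=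
  birkhoffAverage ℝ (dualP p g) (fun f => f x) (n + 1) f

section Cesaro

variable {k : ℕ} {g : Fin k → S1 ≃ₜ S1} {p : Fin k → ℝ}

lemma cesaro_eq (f : S1 → ℝ) (n : ℕ) (x : S1) :
    cesaro p g f n x = ((n + 1 : ℕ) : ℝ)⁻¹ * ∑ j ∈ Finset.range (n + 1), (dualP p g)^[j] f x := rfl

lemma continuous_iterate_dualP {f : S1 → ℝ} (hf : Continuous f) (n : ℕ) :
    Continuous ((dualP p g)^[n] f) := by
  induction n with
  | zero => exact hf
  | succ n ih =>
    rw [Function.iterate_succ_apply']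
    exact continuous_dualP p g ih

lemma abs_dualP_le (hp : ∀ i, 0 < p i) (hsum : ∑ i, p i = 1) {f : S1 → ℝ} {C : ℝ}
    (hC : ∀ x, |f x| ≤ C) (x : S1) : |dualP p g f x| ≤ C := by
  calc |dualP p g f x| ≤ ∑ i, p i * C := by
        refine (Finset.abs_sum_le_sum_abs _ _).trans (Finset.sum_le_sum fun i _ => ?_)
        rw [abs_mul, abs_of_pos (hp i)]
        exact mul_le_mul_of_nonneg_left (hC _) (hp i).le
    _ = C := by rw [← Finset.sum_mul, hsum, one_mul]

lemma abs_iterate_dualP_le (hp : ∀ i, 0 < p i) (hsum : ∑ i, p i = 1) {f : S1 → ℝ} {C : ℝ}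
    (hC : ∀ x, |f x| ≤ C) (n : ℕ) : ∀ x, |(dualP p g)^[n] f x| ≤ C := by
  induction n with
  | zero => exact hC
  | succ n ih =>
    rw [Function.iterate_succ_apply']
    exact abs_dualP_le hp hsum ih

/-- A bound on the terms of an average is a bound on the average. -/
lemma abs_average_le {a : ℕ → ℝ} {C : ℝ} (ha : ∀ j, |a j| ≤ C) (n : ℕ) :
    |((n + 1 : ℕ) : ℝ)⁻¹ * ∑ j ∈ Finset.range (n + 1), a j| ≤ C := by
  have hpos : (0 : ℝ) < ((n + 1 : ℕ) : ℝ) := by positivity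
  rw [abs_mul, abs_of_pos (inv_pos.2 hpos), inv_mul_le_iff₀ hpos]
  refine (Finset.abs_sum_le_sum_abs _ _).trans ((Finset.sum_le_sum fun j _ => ha j).trans ?_)
  simp

lemma OscBound.cesaro {ν : Measure S1} [IsFiniteMeasure ν] (hg : ∀ i, IsOPH (g i))
    (hp : ∀ i, 0 < p i) (hsum : ∑ i, p i = 1)
    (hν : markovP p (fun i => (g i).symm) ν = ν) {ε C : ℝ} (hC : 0 ≤ C) {f : S1 → ℝ}
    (hf : OscBound ν ε C f) (n : ℕ) : OscBound ν ε C (cesaro p g f n) := by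
  have hiter : ∀ j, OscBound ν ε C ((_root_.dualP p g)^[j] f) := fun j => by
    induction j with
    | zero => exact hf
    | succ j ih =>
      rw [Function.iterate_succ_apply']
      exact ih.dualP hg hp hsum hν hC
  intro a b hab
  rw [cesaro_eq, cesaro_eq, ← mul_sub, ← Finset.sum_sub_distrib]
  exact abs_average_le (fun j => hiter j a b hab) n

lemma dualP_cesaro (f : S1 → ℝ) (n : ℕ) (x : S1) :
    dualP p g (cesaro p g f n) x = cesaro p g (dualP p g f) n x := by
  rw [cesaro_eq]
  simp only [← Function.iterate_succ_apply, Function.iterate_succ_apply']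
  simp only [dualP, cesaro_eq, Finset.mul_sum]
  rw [Finset.sum_comm]
  exact Finset.sum_congr rfl fun _ _ => Finset.sum_congr rfl fun _ _ => by ring

lemma integral_cesaro (hp : ∀ i, 0 < p i) {μ : Measure S1} [IsProbabilityMeasure μ]
    (hμ : markovP p g μ = μ) {f : S1 → ℝ} (hf : Continuous f) (n : ℕ) :
    ∫ x, cesaro p g f n x ∂μ = ∫ x, f x ∂μ := by
  have hiter : ∀ j, ∫ x, (dualP p g)^[j] f x ∂μ = ∫ x, f x ∂μ := fun j => by
    induction j with
    | zero => rfl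
    | succ j ih =>
      rw [Function.iterate_succ_apply', ← integral_markovP hp g μ (continuous_iterate_dualP hf j),
        hμ, ih]
  simp only [cesaro_eq]
  rw [integral_const_mul, integral_finsetSum _
    fun j _ => integrable_of_continuous μ (continuous_iterate_dualP hf j)]
  simp only [hiter, Finset.sum_const, Finset.card_range, nsmul_eq_mul]
  rw [inv_mul_cancel_left₀ (by positivity)]

lemma continuous_cesaro {f : S1 → ℝ} (hf : Continuous f) (n : ℕ) :
    Continuous (cesaro p g f n) :=
  continuous_const.mul (continuous_finsetSum _ fun j _ => continuous_iterate_dualP hf j)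

lemma tendsto_cesaro_dualP_sub (hp : ∀ i, 0 < p i) (hsum : ∑ i, p i = 1) {f : S1 → ℝ}
    (hf : Continuous f) (x : S1) :
    Tendsto (fun n => cesaro p g (dualP p g f) n x - cesaro p g f n x) atTop (𝓝 0) := by
  obtain ⟨C, hC⟩ := exists_forall_abs_le hf
  have hb : Bornology.IsBounded
      (Set.range fun j => (fun f : S1 → ℝ => f x) ((dualP p g)^[j] f)) := by
    refine isBounded_iff_forall_norm_le.2 ⟨C, ?_⟩
    rintro _ ⟨j, rfl⟩
    exact abs_iterate_dualP_le hp hsum hC j x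
  exact (tendsto_birkhoffAverage_apply_sub_birkhoffAverage ℝ (f := dualP p g)
    (g := fun f : S1 → ℝ => f x) (x := f) hb).comp (tendsto_add_atTop_nat 1)

end Cesaro

/-- The integral of a continuous function does not depend on the invariant measure: it is the
uniform limit, along an ultrafilter, of the Cesàro averages of the function. -/
lemma exists_integral_eq_of_invariant {k : ℕ} {g : Fin k → S1 ≃ₜ S1} {p : Fin k → ℝ}
    (hg : ∀ i, IsOPH (g i)) (hadm : Admissible g) (hp : ∀ i, 0 < p i) (hsum : ∑ i, p i = 1)
    {f : S1 → ℝ} (hf : Continuous f) :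
    ∃ c, ∀ μ : Measure S1, IsProbabilityMeasure μ → markovP p g μ = μ → ∫ x, f x ∂μ = c := by
  obtain ⟨ν, hνprob, hν⟩ := exists_invariant_measure hp hsum fun i => (g i).symm
  have := isOpenPosMeasure_of_invariant hg hadm hp hν
  have hequi : Equicontinuous (cesaro p g f) := by
    refine equicontinuous_of_oscBound ν (measure_singleton_of_invariant hg hadm hp hsum hν)
      fun ε hε => ?_
    obtain ⟨C, hC, hosc⟩ := exists_oscBound ν hf hε
    exact ⟨C, hC, fun n => hosc.cesaro hg hp hsum hν hC n⟩
  let U : Ultrafilter ℕ := hyperfilter ℕ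
  have hU : (U : Filter ℕ) ≤ atTop := Nat.hyperfilter_le_atTop
  obtain ⟨M, hM⟩ := exists_forall_abs_le hf
  have hlim : ∀ x, ∃ l, Tendsto (fun n => cesaro p g f n x) U (𝓝 l) := fun x => by
    obtain ⟨l, -, hl⟩ := (isCompact_Icc (a := -M) (b := M)).ultrafilter_le_nhds
      (U.map fun n => cesaro p g f n x) (by
        rw [Ultrafilter.coe_map, le_principal_iff, mem_map]
        exact Filter.univ_mem' fun n : ℕ =>
          abs_le.1 (abs_average_le (fun j => abs_iterate_dualP_le hp hsum hM j x) n))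
    exact ⟨l, hl⟩
  choose h hh using hlim
  have hpi : Tendsto (cesaro p g f) U (𝓝 h) := tendsto_pi_nhds.2 hh
  have hcont : Continuous h := hpi.continuous_of_equicontinuous hequi
  have hharm : dualP p g h = h := by
    funext x
    refine tendsto_nhds_unique (f := fun n => dualP p g (cesaro p g f n) x) (l := (U : Filter ℕ))
      (tendsto_finsetSum _ fun i _ => (hh (g i x)).const_mul (p i)) ?_
    simp only [dualP_cesaro]
    simpa using ((tendsto_cesaro_dualP_sub (g := g) hp hsum hf x).mono_left hU).add (hh x)
  obtain ⟨c, hc⟩ := eq_const_of_dualP_eq hg hadm hp hsum hcont hharm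
  have hunif : TendstoUniformly (cesaro p g f) h U := by
    have := (hequi.tendsto_uniformFun_iff_pi (U : Filter ℕ) h).2 hpi
    exact UniformFun.tendsto_iff_tendstoUniformly.1 this
  refine ⟨c, fun μ hμprob hμ => ?_⟩
  refine eq_of_abs_sub_le_all fun ε hε => ?_
  obtain ⟨n, hn⟩ := (Metric.tendstoUniformly_iff.1 hunif ε hε).exists
  have hbound := abs_integral_le_of_forall_abs_le μ (f := fun x => cesaro p g f n x - c) (C := ε)
    fun x => by
      have := hn x
      rw [hc, dist_comm, Real.dist_eq] at this
      exact this.le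
  rwa [integral_sub (integrable_of_continuous μ (continuous_cesaro hf n)) (integrable_const c),
    integral_cesaro hp hμ hf, integral_const, probReal_univ, one_smul] at hbound

/-- The Markov operator of an admissible IFS admits exactly one invariant
Borel probability measure. -/
theorem admissible_ifs_unique_invariant_measure {k : ℕ} (g : Fin k → S1 ≃ₜ S1)
    (hg : ∀ i, IsOPH (g i)) (hadm : Admissible g)
    (p : Fin k → ℝ) (hp : ∀ i, 0 < p i) (hsum : ∑ i, p i = 1) :
    ∃! μs : Measure S1, IsProbabilityMeasure μs ∧ markovP p g μs = μs := by
  obtain ⟨μ, hμprob, hμ⟩ := exists_invariant_measure hp hsum g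
  refine ⟨μ, ⟨hμprob, hμ⟩, ?_⟩
  rintro μ' ⟨hμ'prob, hμ'⟩
  refine ext_of_forall_integral_eq_of_IsFiniteMeasure fun f => ?_
  obtain ⟨c, hc⟩ := exists_integral_eq_of_invariant hg hadm hp hsum f.continuous
  rw [hc μ' hμ'prob hμ', hc μ hμprob hμ]
end
end

section
/- Let h be an orientation-preserving circle homeomorphism with strictly increasing continuous lift H:ℝ→ℝ satisfying H(t+1)=H(t)+1, and let r∈(0,1) be irrational. Assume that h maps every arc of length r onto an arc of length at most r, i.e., H(t+r)−H(t) ≤ r for all t∈ℝ. Then h is a rotation: there exists c∈ℝ such that H(t)=t+c for all t∈ℝ. -/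
/-- A continuous real function on a compact group that does not increase under translation by a
topological generator is constant. -/
theorem eq_of_add_le_of_denseRange_zsmul {G : Type*} [AddGroup G] [TopologicalSpace G]
    [CompactSpace G] [IsTopologicalAddGroup G] {a : G} (ha : DenseRange (· • a : ℤ → G))
    {g : G → ℝ} (hg : Continuous g) (hle : ∀ x, g (x + a) ≤ g x) (x y : G) : g x = g y := by
  obtain ⟨m, -, hm⟩ := isCompact_univ.exists_isMinOn (Set.univ_nonempty (α := G)) hg.continuousOn
  replace hm : ∀ z, g m ≤ g z := fun z => hm (Set.mem_univ z)
  have horbit : ∀ n : ℕ, g (m + n • a) ≤ g m := by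
    intro n
    induction n with
    | zero => simp
    | succ n ih =>
      rw [succ_nsmul, ← add_assoc]
      exact (hle _).trans ih
  have hmin : ∀ z, g (m + z) ≤ g m := fun z =>
    (denseRange_zsmul_iff_nsmul.1 ha).induction_on z
      (isClosed_le (by fun_prop) continuous_const) horbit
  have hconst : ∀ z, g z = g m := fun z =>
    le_antisymm (by simpa using hmin (-m + z)) (hm z)
  rw [hconst x, hconst y]


/-- If `H` is a strictly increasing continuous lift of a circle homeomorphism
(`H (t+1) = H t + 1`) and for an irrational `r ∈ (0,1)` one has `H (t+r) - H t ≤ r` for all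
`t`, then `H` is (the lift of) a rotation: `H t = t + c` for some constant `c`. -/
theorem rotation_of_contracts_irrational_arcs (H : ℝ → ℝ)
    (hmono : StrictMono H) (hcont : Continuous H)
    (hper : ∀ t : ℝ, H (t + 1) = H t + 1)
    (r : ℝ) (hr : r ∈ Set.Ioo (0 : ℝ) 1) (hirr : Irrational r)
    (harc : ∀ t : ℝ, H (t + r) - H t ≤ r) :
    ∃ c : ℝ, ∀ t : ℝ, H t = t + c := by
  have hφ : Function.Periodic (fun t => H t - t) 1 := fun t => by
    simp only [hper]
    ring
  have hlift : Continuous (hφ.lift : AddCircle (1 : ℝ) → ℝ) :=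
    (hcont.sub continuous_id).quotient_lift _
  have hle : ∀ x : AddCircle (1 : ℝ), hφ.lift (x + (r : AddCircle (1 : ℝ))) ≤ hφ.lift x := by
    intro x
    induction x using QuotientAddGroup.induction_on with
    | H t =>
      rw [← AddCircle.coe_add, hφ.lift_coe, hφ.lift_coe]
      linarith [harc t]
  have hdense : DenseRange (· • (r : AddCircle (1 : ℝ)) : ℤ → AddCircle (1 : ℝ)) :=
    AddCircle.denseRange_zsmul_coe_iff.2 (by simpa using hirr)
  refine ⟨H 0 - 0, fun t => ?_⟩
  have h := eq_of_add_le_of_denseRange_zsmul hdense hlift hle t (0 : ℝ)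
  rw [hφ.lift_coe, hφ.lift_coe] at h
  linarith
end

section
/- Let Γ={g₁,…,g_k} be a finite set of orientation-preserving circle homeomorphisms, p=(p₁,…,p_k) a probability vector with all pᵢ>0, and P the associated Markov operator. Let μ be a P-invariant Borel probability measure, let Ω={1,…,k}^ℕ and let ℙ be the product of countably many copies of the distribution p on Ω. Then for ℙ-almost every ω=(i₁,i₂,…)∈Ω there exists a Borel probability measure ν_ω on S¹ such that the pushforward of μ under g_{i₁}∘g_{i₂}∘⋯∘g_{i_n} converges weakly to ν_ω as n→∞, i.e., ∫ f(g_{i₁}∘g_{i₂}∘⋯∘g_{i_n}(x)) dμ(x) → ∫ f dν_ω for every continuous f:S¹→ℝ. -/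
open MeasureTheory Filter Topology

noncomputable section

/-- For `ω = (i₁, i₂, …)`, `backComp g ω n = g_{i₁} ∘ g_{i₂} ∘ ⋯ ∘ g_{i_n}`
(here `i_j = ω (j-1)`). -/
def backComp {k : ℕ} (g : Fin k → S1 ≃ₜ S1) (ω : ℕ → Fin k) : ℕ → S1 → S1
  | 0 => id
  | n + 1 => backComp g ω n ∘ fun x => g (ω n) x

section Cylinders

variable {k : ℕ}

/-- The σ-algebra generated by the first `n` coordinates of `ℕ → Fin k`. -/
def coordFiltration (k : ℕ) : Filtration ℕ (inferInstance : MeasurableSpace (ℕ → Fin k)) where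
  seq n := MeasurableSpace.comap (fun ω (j : Fin n) => ω j) inferInstance
  mono' n m hnm := by
    refine MeasurableSpace.comap_le_iff_le_map.2 fun s hs => ?_
    exact ⟨(fun (c : Fin m → Fin k) (j : Fin n) => c (Fin.castLE hnm j)) ⁻¹' s,
      .of_discrete, rfl⟩
  le' n := Measurable.comap_le (by fun_prop)

lemma measurableSet_coordFiltration_iff {n : ℕ} {A : Set (ℕ → Fin k)} :
    MeasurableSet[coordFiltration k n] A ↔
      ∀ ω ω', (∀ j < n, ω j = ω' j) → ω ∈ A → ω' ∈ A := by
  constructor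
  · rintro ⟨s, -, rfl⟩ ω ω' h hω
    have : (fun j : Fin n => ω j) = fun j : Fin n => ω' j := funext fun j => h j j.2
    simpa only [Set.mem_preimage, ← this] using hω
  · intro h
    refine ⟨(fun ω (j : Fin n) => ω j) '' A, .of_discrete, ?_⟩
    refine Set.Subset.antisymm ?_ (Set.subset_preimage_image _ _)
    rintro ω' ⟨ω, hω, he⟩
    exact h ω ω' (fun j hj => congrFun he ⟨j, hj⟩) hω

lemma measurableSet_cylinder (n : ℕ) (c : ℕ → Fin k) :
    MeasurableSet {ω : ℕ → Fin k | ∀ j < n, ω j = c j} :=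
  (coordFiltration k).le n _ <| measurableSet_coordFiltration_iff.2
    fun _ _ h hω j hj => (h j hj).symm.trans (hω j hj)

/-- Two integrable functions with equal integrals over all cylinders of length `n` have equal
integrals over all sets depending on the first `n` coordinates only. -/
lemma setIntegral_eq_of_cylinders {ℙ : Measure (ℕ → Fin k)} {n : ℕ} {φ ψ : (ℕ → Fin k) → ℝ}
    (hφ : Integrable φ ℙ) (hψ : Integrable ψ ℙ)
    (h : ∀ c : ℕ → Fin k, ∫ ω in {ω | ∀ j < n, ω j = c j}, φ ω ∂ℙ =
      ∫ ω in {ω | ∀ j < n, ω j = c j}, ψ ω ∂ℙ)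
    {A : Set (ℕ → Fin k)} (hA : MeasurableSet[coordFiltration k n] A) :
    ∫ ω in A, φ ω ∂ℙ = ∫ ω in A, ψ ω ∂ℙ := by
  set B : (Fin n → Fin k) → Set (ℕ → Fin k) := fun c => A ∩ {ω | (fun j : Fin n => ω j) = c}
  have hBm : ∀ c, MeasurableSet (B c) := fun c =>
    ((coordFiltration k).le n _ hA).inter
      ((show Measurable fun (ω : ℕ → Fin k) (j : Fin n) => ω j by fun_prop)
        (measurableSet_singleton c))
  have hBd : Pairwise (Function.onFun Disjoint B) := fun c d hcd =>
    Set.disjoint_left.2 fun ω hc hd => hcd (hc.2.symm.trans hd.2)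
  have hAB : A = ⋃ c, B c := by
    ext ω
    simp [B]
  rw [hAB, integral_iUnion_fintype hBm hBd fun c => hφ.integrableOn,
    integral_iUnion_fintype hBm hBd fun c => hψ.integrableOn]
  refine Finset.sum_congr rfl fun c _ => ?_
  obtain hc | ⟨ω, hω, rfl⟩ := (B c).eq_empty_or_nonempty
  · simp [hc]
  · have : B (fun j => ω j) = {ω' | ∀ j < n, ω' j = ω j} := by
      ext ω'
      refine ⟨fun h' j hj => congrFun h'.2 ⟨j, hj⟩, fun h' => ⟨?_, funext fun j => h' j j.2⟩⟩
      exact measurableSet_coordFiltration_iff.1 hA ω ω' (fun j hj => (h' j hj).symm) hω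
    rw [this, h]

end Cylinders

section BackwardImages

variable {k : ℕ} {g : Fin k → S1 ≃ₜ S1}

lemma continuous_backComp (ω : ℕ → Fin k) (n : ℕ) : Continuous (backComp g ω n) := by
  induction n with
  | zero => exact continuous_id
  | succ n ih => exact ih.comp (g (ω n)).continuous

lemma backComp_congr {ω ω' : ℕ → Fin k} {n : ℕ} (h : ∀ j < n, ω j = ω' j) :
    backComp g ω n = backComp g ω' n := by
  induction n with
  | zero => rfl
  | succ n ih =>
    simp only [backComp, ih fun j hj => h j (hj.trans n.lt_succ_self), h n n.lt_succ_self]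

lemma integrable_comp_backComp (μ : Measure S1) [IsFiniteMeasure μ] (f : C(S1, ℝ))
    (ω : ℕ → Fin k) (n : ℕ) : Integrable (fun x => f (backComp g ω n x)) μ :=
  (f.continuous.comp (continuous_backComp ω n)).integrable_of_hasCompactSupport
    (HasCompactSupport.of_compactSpace _)

lemma integral_eq_sum_of_markovP_eq {p : Fin k → ℝ} (hp : ∀ i, 0 ≤ p i) {μ : Measure S1}
    [IsFiniteMeasure μ] (hinv : markovP p g μ = μ) (f : C(S1, ℝ)) :
    ∫ x, f x ∂μ = ∑ i, p i * ∫ x, f (g i x) ∂μ := by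
  have hint (ν : Measure S1) [IsFiniteMeasure ν] : Integrable f ν :=
    f.continuous.integrable_of_hasCompactSupport (HasCompactSupport.of_compactSpace _)
  conv_lhs => rw [← hinv, markovP]
  rw [integral_finsetSum_measure fun i _ => (hint _).smul_measure ENNReal.ofReal_ne_top]
  refine Finset.sum_congr rfl fun i _ => ?_
  rw [integral_smul_measure, ENNReal.toReal_ofReal (hp i), smul_eq_mul,
    integral_map (g i).continuous.aemeasurable f.continuous.aestronglyMeasurable]

lemma stronglyMeasurable_integral_backComp (μ : Measure S1) (f : C(S1, ℝ)) (n : ℕ) :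
    StronglyMeasurable[coordFiltration k n] fun ω => ∫ x, f (backComp g ω n x) ∂μ := by
  refine Measurable.stronglyMeasurable fun s _ => measurableSet_coordFiltration_iff.2 ?_
  intro ω ω' h hω
  simpa only [Set.mem_preimage, backComp_congr h] using hω

lemma norm_integral_comp_backComp_le (μ : Measure S1) [IsProbabilityMeasure μ] (f : C(S1, ℝ))
    (ω : ℕ → Fin k) (n : ℕ) : ‖∫ x, f (backComp g ω n x) ∂μ‖ ≤ ‖f‖ := by
  simpa using norm_integral_le_of_norm_le_const (μ := μ)
    (Eventually.of_forall fun x => f.norm_coe_le_norm (backComp g ω n x))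

lemma integrable_integral_backComp (μ : Measure S1) [IsProbabilityMeasure μ]
    (ℙ : Measure (ℕ → Fin k)) [IsFiniteMeasure ℙ] (f : C(S1, ℝ)) (n : ℕ) :
    Integrable (fun ω => ∫ x, f (backComp g ω n x) ∂μ) ℙ :=
  .of_bound ((stronglyMeasurable_integral_backComp μ f n).mono
    ((coordFiltration k).le n)).aestronglyMeasurable ‖f‖
    (Eventually.of_forall fun ω => norm_integral_comp_backComp_le μ f ω n)

variable {p : Fin k → ℝ} {μ : Measure S1} {ℙ : Measure (ℕ → Fin k)}

lemma setIntegral_cylinder_integral_backComp (n : ℕ) (c : ℕ → Fin k) (f : C(S1, ℝ)) :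
    ∫ ω in {ω | ∀ j < n, ω j = c j}, (∫ x, f (backComp g ω n x) ∂μ) ∂ℙ =
      ℙ.real {ω | ∀ j < n, ω j = c j} * ∫ x, f (backComp g c n x) ∂μ := by
  rw [setIntegral_congr_fun (g := fun _ => ∫ x, f (backComp g c n x) ∂μ)
    (measurableSet_cylinder n c) fun ω hω => ?_]
  · simp
  · simp only [backComp_congr hω]

/-- The integrals of `f` against the backward images of an invariant measure form a martingale. -/
lemma martingale_integral_backComp (hp : ∀ i, 0 ≤ p i) [IsProbabilityMeasure μ]
    (hinv : markovP p g μ = μ) [IsFiniteMeasure ℙ]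
    (hprod : ∀ (n : ℕ) (c : ℕ → Fin k),
      ℙ {ω | ∀ j < n, ω j = c j} = ∏ j ∈ Finset.range n, ENNReal.ofReal (p (c j)))
    (f : C(S1, ℝ)) :
    Martingale (fun n ω => ∫ x, f (backComp g ω n x) ∂μ) (coordFiltration k) ℙ := by
  have hreal (n : ℕ) (c : ℕ → Fin k) :
      ℙ.real {ω | ∀ j < n, ω j = c j} = ∏ j ∈ Finset.range n, p (c j) := by
    simp [measureReal_def, hprod, ENNReal.toReal_prod, ENNReal.toReal_ofReal, hp]
  refine martingale_of_setIntegral_eq_succ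
    (fun n => stronglyMeasurable_integral_backComp μ f n)
    (fun n => integrable_integral_backComp μ ℙ f n) fun n A hA =>
    setIntegral_eq_of_cylinders (integrable_integral_backComp μ ℙ f n)
      (integrable_integral_backComp μ ℙ f (n + 1)) (fun c => ?_) hA
  have hne (i : Fin k) : ∀ j < n, Function.update c n i j = c j := fun j hj =>
    Function.update_of_ne hj.ne _ _
  have hunion : {ω : ℕ → Fin k | ∀ j < n, ω j = c j} =
      ⋃ i, {ω | ∀ j < n + 1, ω j = Function.update c n i j} := by
    ext ω
    simp only [Set.mem_ofPred_eq, Set.mem_iUnion, Order.lt_add_one_iff]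
    refine ⟨fun h => ⟨ω n, fun j hj => ?_⟩, fun ⟨i, h⟩ j hj => (h j hj.le).trans (hne i j hj)⟩
    obtain hj | rfl := hj.lt_or_eq
    · rw [hne _ j hj, h j hj]
    · simp
  have hdisj : Pairwise (Function.onFun Disjoint
      fun i => {ω : ℕ → Fin k | ∀ j < n + 1, ω j = Function.update c n i j}) := fun i i' hii =>
    Set.disjoint_left.2 fun ω h h' => hii <| by
      simpa using (h n n.lt_succ_self).symm.trans (h' n n.lt_succ_self)
  rw [setIntegral_cylinder_integral_backComp, hunion,
    integral_iUnion_fintype (fun i => measurableSet_cylinder _ _) hdisj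
      fun i => (integrable_integral_backComp μ ℙ f (n + 1)).integrableOn, ← hunion]
  have hf := integral_eq_sum_of_markovP_eq hp hinv
    (f.comp ⟨backComp g c n, continuous_backComp c n⟩)
  simp only [ContinuousMap.comp_apply, ContinuousMap.coe_mk] at hf
  rw [hf, Finset.mul_sum]
  refine Finset.sum_congr rfl fun i _ => ?_
  rw [setIntegral_cylinder_integral_backComp, hreal, hreal, Finset.prod_range_succ,
    Finset.prod_congr rfl fun j hj => congrArg p (hne i j (Finset.mem_range.1 hj))]
  simp [backComp, backComp_congr (hne i), mul_assoc]

lemma ae_exists_tendsto_integral_backComp (hp : ∀ i, 0 ≤ p i) [IsProbabilityMeasure μ]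
    (hinv : markovP p g μ = μ) [IsProbabilityMeasure ℙ]
    (hprod : ∀ (n : ℕ) (c : ℕ → Fin k),
      ℙ {ω | ∀ j < n, ω j = c j} = ∏ j ∈ Finset.range n, ENNReal.ofReal (p (c j)))
    (f : C(S1, ℝ)) :
    ∀ᵐ ω ∂ℙ, ∃ l, Tendsto (fun n => ∫ x, f (backComp g ω n x) ∂μ) atTop (𝓝 l) := by
  refine (martingale_integral_backComp hp hinv hprod f).submartingale.exists_ae_tendsto_of_bdd
    (R := ‖f‖₊) fun n => ?_
  refine (eLpNorm_le_of_ae_bound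
    (Eventually.of_forall fun ω => norm_integral_comp_backComp_le μ f ω n)).trans ?_
  simp [← enorm_eq_nnnorm]

end BackwardImages

/-- A sequence of probability measures on a compact space whose integrals converge on a dense set
of continuous functions converges weakly. -/
lemma exists_forall_tendsto_integral_of_dense {X : Type*} [TopologicalSpace X] [CompactSpace X]
    [T2Space X] [MeasurableSpace X] [BorelSpace X] (m : ℕ → ProbabilityMeasure X)
    {D : Set C(X, ℝ)} (hD : Dense D)
    (h : ∀ f ∈ D, ∃ l, Tendsto (fun n => ∫ x, f x ∂(m n : Measure X)) atTop (𝓝 l)) :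
    ∃ ν : ProbabilityMeasure X, ∀ f : C(X, ℝ),
      Tendsto (fun n => ∫ x, f x ∂(m n : Measure X)) atTop (𝓝 (∫ x, f x ∂(ν : Measure X))) := by
  have hint (f : C(X, ℝ)) (ν : ProbabilityMeasure X) : Integrable f (ν : Measure X) :=
    f.continuous.integrable_of_hasCompactSupport (HasCompactSupport.of_compactSpace _)
  have hlip (ν : ProbabilityMeasure X) :
      LipschitzWith 1 fun f : C(X, ℝ) => ∫ x, f x ∂(ν : Measure X) := by
    refine LipschitzWith.of_dist_le_mul fun f f' => ?_
    rw [dist_eq_norm, dist_eq_norm, ← integral_sub (hint f ν) (hint f' ν)]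
    simpa using norm_integral_le_of_norm_le_const (μ := (ν : Measure X))
      (Eventually.of_forall fun x => (f - f').norm_coe_le_norm x)
  have : Nonempty (ProbabilityMeasure X) := ⟨m 0⟩
  set U : Ultrafilter ℕ := Ultrafilter.of atTop
  set ν : ProbabilityMeasure X := (U.map m).lim
  have hν : Tendsto m U (𝓝 ν) := (U.map m).le_nhds_lim
  refine ⟨ν, fun f => ?_⟩
  have hclosed := (LipschitzWith.uniformEquicontinuous
    (fun n (f : C(X, ℝ)) => ∫ x, f x ∂(m n : Measure X)) 1
    fun n => hlip (m n)).equicontinuous.isClosed_setOfPred_tendsto (l := atTop) (hlip ν).continuous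
  refine hclosed.closure_subset_iff.2 (fun f hf => ?_) (hD f)
  obtain ⟨l, hl⟩ := h f hf
  have hU := ProbabilityMeasure.tendsto_iff_forall_integral_tendsto.1 hν
    (BoundedContinuousFunction.mkOfCompact f)
  have := tendsto_nhds_unique (hl.mono_left (Ultrafilter.of_le atTop)) hU
  simpa [this] using hl

/-- For a `P`-invariant probability measure `μ` and the product measure `ℙ`
on `Ω = {1,…,k}^ℕ` (characterized on cylinder sets), for `ℙ`-a.e. `ω` the pushforwards of `μ`
under `g_{i₁} ∘ ⋯ ∘ g_{i_n}` converge weakly to some probability measure `ν_ω`. -/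
theorem backward_images_converge_weakly_ae {k : ℕ} (g : Fin k → S1 ≃ₜ S1)
    (hg : ∀ i, IsOPH (g i))
    (p : Fin k → ℝ) (hp : ∀ i, 0 < p i) (hsum : ∑ i, p i = 1)
    (μ : Measure S1) (hμ : IsProbabilityMeasure μ) (hinv : markovP p g μ = μ)
    (ℙ : Measure (ℕ → Fin k)) (hℙ : IsProbabilityMeasure ℙ)
    (hprod : ∀ (n : ℕ) (c : ℕ → Fin k),
      ℙ {ω | ∀ j < n, ω j = c j} = ∏ j ∈ Finset.range n, ENNReal.ofReal (p (c j))) :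
    ∀ᵐ ω ∂ℙ, ∃ ν : Measure S1, IsProbabilityMeasure ν ∧
      ∀ f : C(S1, ℝ),
        Tendsto (fun n => ∫ x, f (backComp g ω n x) ∂μ) atTop (𝓝 (∫ x, f x ∂ν)) := by
  obtain ⟨D, hDc, hD⟩ := TopologicalSpace.exists_countable_dense C(S1, ℝ)
  have hae : ∀ᵐ ω ∂ℙ, ∀ f ∈ D, ∃ l,
      Tendsto (fun n => ∫ x, f (backComp g ω n x) ∂μ) atTop (𝓝 l) :=
    (ae_ball_iff hDc).2 fun f _ =>
      ae_exists_tendsto_integral_backComp (fun i => (hp i).le) hinv hprod f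
  filter_upwards [hae] with ω hω
  have hmeas (n : ℕ) : AEMeasurable (backComp g ω n) μ :=
    (continuous_backComp ω n).aemeasurable
  have hmap (f : C(S1, ℝ)) (n : ℕ) :
      ∫ x, f x ∂(μ.map (backComp g ω n)) = ∫ x, f (backComp g ω n x) ∂μ :=
    integral_map (hmeas n) f.continuous.aestronglyMeasurable
  obtain ⟨ν, hν⟩ := exists_forall_tendsto_integral_of_dense
    (fun n => ⟨μ.map (backComp g ω n), Measure.isProbabilityMeasure_map (hmeas n)⟩) hD
    (by simpa only [ProbabilityMeasure.coe_mk, hmap] using hω)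
  exact ⟨ν, inferInstance, by simpa only [ProbabilityMeasure.coe_mk, hmap] using hν⟩
end
end
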